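/- arXiv:1011.5438 — 2 statements merged into one kernel-verified Lean document; each statement's English description precedes it below -/
import Mathlib

section
/- Let p be a prime, α a positive integer, and k = p^α. Let A be a finite set of integers with |A| ≥ (k−1)²·k!. Then |A + k·A| ≥ (k+1)|A| − ⌈k(k+2)/4⌉. -/
open Finset Pointwise

namespace SD

def cls (k : ℕ) (A : Finset ℤ) (r : ℤ) : Finset ℤ := A.filter (fun a => a % (k : ℤ) = r)
def quo (k : ℕ) (A : Finset ℤ) (r : ℤ) : Finset ℤ := (cls k A r).image (fun a => a / (k : ℤ))
def res (k : ℕ) (A : Finset ℤ) : Finset ℤ := A.image (fun a => a % (k : ℤ))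
def dil (k : ℕ) (A : Finset ℤ) : Finset ℤ := A.image (fun b => (k : ℤ) * b)
def f (k : ℕ) (A : Finset ℤ) : ℕ := (A + dil k A).card

lemma mem_cls {k : ℕ} {A : Finset ℤ} {r a : ℤ} : a ∈ cls k A r ↔ a ∈ A ∧ a % (k:ℤ) = r := by
  simp [cls]

lemma mem_quo {k : ℕ} (hk : 0 < k) {A : Finset ℤ} {r x : ℤ} (hr : r ∈ res k A) :
    x ∈ quo k A r ↔ r + k * x ∈ A := by
  have hk' : (0:ℤ) < k := by exact_mod_cast hk
  obtain ⟨a, ha, rfl⟩ := Finset.mem_image.1 hr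
  simp only [quo, Finset.mem_image, mem_cls]
  constructor
  · rintro ⟨b, ⟨hb, hb2⟩, rfl⟩
    rw [← hb2, Int.emod_add_mul_ediv]; exact hb
  · intro h
    refine ⟨_, ⟨h, ?_⟩, ?_⟩
    · simp
    · rw [Int.add_mul_ediv_left _ _ hk'.ne', Int.ediv_eq_zero_of_lt (Int.emod_nonneg _ hk'.ne') (Int.emod_lt_of_pos _ hk')]
      simp

lemma cls_eq {k : ℕ} (hk : 0 < k) {A : Finset ℤ} {r : ℤ} (hr : r ∈ res k A) :
    cls k A r = (quo k A r).image (fun x => r + k * x) := by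
  have hk' : (0:ℤ) < k := by exact_mod_cast hk
  ext a
  rw [Finset.mem_image]
  constructor
  · intro h
    refine ⟨a / k, Finset.mem_image_of_mem _ h, ?_⟩
    rw [← (mem_cls.1 h).2, Int.emod_add_mul_ediv]
  · rintro ⟨x, hx, rfl⟩
    have := (mem_quo hk hr).1 hx
    refine mem_cls.2 ⟨this, ?_⟩
    obtain ⟨b, hb, rfl⟩ := Finset.mem_image.1 hr
    simp

lemma inj_aff {k : ℕ} (hk : 0 < k) (r : ℤ) : Function.Injective (fun x : ℤ => r + k * x) := by
  have hk' : (k:ℤ) ≠ 0 := by exact_mod_cast hk.ne'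
  intro x y h
  exact mul_left_cancel₀ hk' (add_left_cancel h)

lemma card_quo {k : ℕ} (hk : 0 < k) {A : Finset ℤ} {r : ℤ} (hr : r ∈ res k A) :
    (quo k A r).card = (cls k A r).card := by
  rw [cls_eq hk hr, Finset.card_image_of_injective _ (inj_aff hk r)]

lemma cls_nonempty {k : ℕ} {A : Finset ℤ} {r : ℤ} (hr : r ∈ res k A) :
    (cls k A r).Nonempty := by
  obtain ⟨a, ha, rfl⟩ := Finset.mem_image.1 hr
  exact ⟨a, mem_cls.2 ⟨ha, rfl⟩⟩

lemma quo_nonempty {k : ℕ} {A : Finset ℤ} {r : ℤ} (hr : r ∈ res k A) :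
    (quo k A r).Nonempty := (cls_nonempty hr).image _

lemma sum_cls (k : ℕ) (A : Finset ℤ) : ∑ r ∈ res k A, (cls k A r).card = A.card :=
  (Finset.card_eq_sum_card_image _ _).symm

lemma dil_card {k : ℕ} (hk : 0 < k) (A : Finset ℤ) : (dil k A).card = A.card := by
  have := Finset.card_image_of_injective A (inj_aff hk 0)
  simpa [dil] using this

/-- decomposition of `X + k·B` along residues of `X`. -/
lemma card_decomp {k : ℕ} (hk : 0 < k) (X B : Finset ℤ) :
    (X + dil k B).card = ∑ r ∈ res k X, (quo k X r + B).card := by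
  have hk' : (0:ℤ) < k := by exact_mod_cast hk
  rw [Finset.card_eq_sum_card_fiberwise (f := fun a : ℤ => a % (k:ℤ)) (t := res k X)]
  · refine Finset.sum_congr rfl fun r hr => ?_
    rw [← Finset.card_image_of_injective (quo k X r + B) (inj_aff hk r)]
    congr 1
    ext a
    simp only [Finset.mem_filter, Finset.mem_image, Finset.mem_add, dil]
    constructor
    · rintro ⟨⟨x, hx, _, ⟨b, hb, rfl⟩, rfl⟩, h⟩
      have h2 : x % (k:ℤ) = r := by simpa using h
      refine ⟨x / k + b, ⟨x / k, ?_, b, hb, rfl⟩, ?_⟩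
      · exact Finset.mem_image_of_mem _ (mem_cls.2 ⟨hx, h2⟩)
      · have := Int.emod_add_mul_ediv x k
        rw [h2] at this
        linear_combination this
    · rintro ⟨_, ⟨y, hy, b, hb, rfl⟩, rfl⟩
      have hy' := (mem_quo hk hr).1 hy
      refine ⟨⟨_, hy', _, ⟨b, hb, rfl⟩, by ring⟩, ?_⟩
      obtain ⟨c, hc, rfl⟩ := Finset.mem_image.1 hr
      simp
  · intro a ha
    simp only [Finset.mem_coe, Finset.mem_add, dil, Finset.mem_image] at ha
    obtain ⟨x, hx, _, ⟨b, hb, rfl⟩, rfl⟩ := ha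
    simp only [Finset.mem_coe, res, Finset.mem_image]
    exact ⟨x, hx, by simp⟩

lemma f_decomp {k : ℕ} (hk : 0 < k) (A : Finset ℤ) :
    f k A = ∑ r ∈ res k A, (quo k A r + A).card := card_decomp hk A A

lemma card_add_ge {X B : Finset ℤ} (hX : X.Nonempty) (hB : B.Nonempty) :
    X.card + B.card ≤ (X + B).card + 1 := by
  have := cauchy_davenport_add_of_linearOrder_isCancelAdd hX hB
  omega

/-- `B` in one class mod `q`. -/
lemma card_add_class (q : ℕ) {X B : Finset ℤ} (hB : B.Nonempty) (b0 : ℤ)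
    (h : ∀ b ∈ B, b % (q:ℤ) = b0) :
    X.card + (res q X).card * B.card ≤ (X + B).card + (res q X).card := by
  have h1 : ((res q X).biUnion (fun r => cls q X r + B)).card = ∑ r ∈ res q X, (cls q X r + B).card := by
    apply Finset.card_biUnion
    intro r hr s hs hrs
    refine Finset.disjoint_left.2 ?_
    intro a ha ha2
    obtain ⟨x, hx, b, hb, rfl⟩ := Finset.mem_add.1 ha
    obtain ⟨y, hy, c, hc, hh⟩ := Finset.mem_add.1 ha2
    apply hrs
    rw [← (mem_cls.1 hx).2, ← (mem_cls.1 hy).2]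
    have e1 : b ≡ c [ZMOD q] := by rw [Int.ModEq, h _ hb, h _ hc]
    have e2 : y + c ≡ x + b [ZMOD q] := by rw [hh]
    exact (Int.ModEq.add_right_cancel e1.symm e2).symm
  have h2 : ((res q X).biUnion (fun r => cls q X r + B)) ⊆ X + B := by
    intro a ha
    obtain ⟨r, hr, ha⟩ := Finset.mem_biUnion.1 ha
    exact Finset.add_subset_add_right (Finset.filter_subset _ _) ha
  have h3 : ∑ r ∈ res q X, ((cls q X r).card + B.card) ≤ ∑ r ∈ res q X, ((cls q X r + B).card + 1) :=
    Finset.sum_le_sum fun r hr => card_add_ge (cls_nonempty hr) hB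
  have h4 := Finset.card_le_card h2
  rw [Finset.sum_add_distrib, Finset.sum_add_distrib, sum_cls] at h3
  simp only [Finset.sum_const, smul_eq_mul, mul_one] at h3
  omega

lemma f_ge {k : ℕ} (hk : 0 < k) (A : Finset ℤ) (hA : A.Nonempty) :
    A.card + (res k A).card * A.card ≤ f k A + (res k A).card := by
  have := card_add_class k (X := A) (B := dil k A) (hA.image _) 0 (by
    intro b hb
    obtain ⟨c, hc, rfl⟩ := Finset.mem_image.1 hb
    simp)
  rwa [dil_card hk] at this

lemma res_card_le {k : ℕ} (hk : 0 < k) (A : Finset ℤ) : (res k A).card ≤ k := by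
  have hk' : (0:ℤ) < k := by exact_mod_cast hk
  have : res k A ⊆ Finset.Ico (0:ℤ) k := by
    intro a ha
    obtain ⟨c, hc, rfl⟩ := Finset.mem_image.1 ha
    rw [Finset.mem_Ico]
    exact ⟨Int.emod_nonneg _ hk'.ne', Int.emod_lt_of_pos _ hk'⟩
  simpa using Finset.card_le_card this

/-- meets all classes -/
lemma res_card_full {k : ℕ} (hk : 0 < k) (A : Finset ℤ)
    (h : ∀ z : ℤ, ∃ y ∈ A, (k:ℤ) ∣ y - z) : (res k A).card = k := by
  have hk' : (0:ℤ) < k := by exact_mod_cast hk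
  apply le_antisymm (res_card_le hk A)
  have : Finset.Ico (0:ℤ) k ⊆ res k A := by
    intro a ha
    rw [Finset.mem_Ico] at ha
    obtain ⟨y, hy, hd⟩ := h a
    refine Finset.mem_image.2 ⟨y, hy, ?_⟩
    have h1 : y % (k:ℤ) = a % k := Int.emod_eq_emod_iff_emod_sub_eq_zero.2 (Int.emod_eq_zero_of_dvd hd)
    rw [Int.emod_eq_of_lt ha.1 ha.2] at h1
    exact h1
  simpa using Finset.card_le_card this

/-- closure lemma -/
lemma closure {X : Finset ℤ} {N : ℕ} (hN : 0 < N) {d : ℤ}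
    (h : ∀ x ∈ X, ∃ y ∈ X, (N:ℤ) ∣ y - (x + d)) :
    ∀ x ∈ X, ∀ w : ℤ, ((Int.gcd d N : ℕ) : ℤ) ∣ w → ∃ y ∈ X, (N:ℤ) ∣ y - (x + w) := by
  have hN' : (0:ℤ) < N := by exact_mod_cast hN
  have key : ∀ n : ℕ, ∀ x ∈ X, ∃ y ∈ X, (N:ℤ) ∣ y - (x + n * d) := by
    intro n
    induction n with
    | zero => intro x hx; exact ⟨x, hx, by simp⟩
    | succ n ih =>
      intro x hx
      obtain ⟨y, hy, hyd⟩ := ih x hx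
      obtain ⟨z, hz, hzd⟩ := h y hy
      refine ⟨z, hz, ?_⟩
      have := dvd_add hzd hyd
      have e : z - (x + ((n+1:ℕ):ℤ) * d) = z - (y + d) + (y - (x + n * d)) := by push_cast; ring
      rw [e]; exact this
  rintro x hx w ⟨c, rfl⟩
  obtain ⟨y, hy, hyd⟩ := key ((Int.gcdA d N * c) % N).toNat x hx
  refine ⟨y, hy, ?_⟩
  rw [Int.toNat_of_nonneg (Int.emod_nonneg _ hN'.ne')] at hyd
  have e1 := Int.gcd_eq_gcd_ab d N
  have e2 := Int.emod_add_mul_ediv (Int.gcdA d N * c) N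
  have : y - (x + (Int.gcd d N : ℤ) * c) = (y - (x + (Int.gcdA d N * c) % N * d)) 
     + N * (- (Int.gcdA d N * c / N) * d - Int.gcdB d N * c) := by
    rw [e1]
    linear_combination d * e2
  rw [this]
  exact dvd_add hyd (dvd_mul_right _ _)

def Per (p α : ℕ) (X : Finset ℤ) (γ : ℕ) : Prop :=
  ∀ x ∈ X, ∀ z : ℤ, ∃ y ∈ X, ((p ^ α : ℕ) : ℤ) ∣ y - (x + (p:ℤ) ^ γ * z)

lemma exists_per (p α : ℕ) (X : Finset ℤ) :
    ∃ γ, γ ≤ α ∧ Per p α X γ ∧ ∀ γ' < γ, ¬ Per p α X γ' := by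
  classical
  have h : ∃ γ, Per p α X γ := ⟨α, fun x hx z => ⟨x, hx, ⟨-z, by push_cast; ring⟩⟩⟩
  refine ⟨Nat.find h, Nat.find_min' h ?_, Nat.find_spec h, fun γ' h' => Nat.find_min h h'⟩
  exact fun x hx z => ⟨x, hx, ⟨-z, by push_cast; ring⟩⟩

lemma exists_escape {p α : ℕ} (hp : p.Prime) {X : Finset ℤ} {γ : ℕ} 
    (hmin : ∀ γ' < γ, ¬ Per p α X γ') {d : ℤ} (hd : ¬ (p:ℤ)^γ ∣ d) :
    ∃ x ∈ X, ∀ y ∈ X, ¬ ((p ^ α : ℕ) : ℤ) ∣ y - (x + d) := by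
  by_contra hcon
  push Not at hcon
  have hcl := closure (pow_pos hp.pos α) hcon
  have hg : Int.gcd d ((p^α : ℕ):ℤ) ∣ p ^ α := by
    have := Int.gcd_dvd_right d ((p^α : ℕ):ℤ)
    exact_mod_cast this
  obtain ⟨e, he, hge⟩ := (Nat.dvd_prime_pow hp).1 hg
  have heγ : e < γ := by
    by_contra hle
    push Not at hle
    apply hd
    have h1 : ((Int.gcd d ((p^α : ℕ):ℤ) : ℕ) : ℤ) ∣ d := Int.gcd_dvd_left d _
    rw [hge] at h1
    push_cast at h1
    exact (pow_dvd_pow _ hle).trans h1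
  apply hmin e heγ
  intro x hx z
  apply hcl x hx
  rw [hge]
  push_cast
  exact dvd_mul_right _ _

lemma dvd_of_mem_cls {k : ℕ} {A : Finset ℤ} {r a : ℤ} (h : a ∈ cls k A r) : (k:ℤ) ∣ a - r := by
  rw [← (mem_cls.1 h).2]
  exact Int.dvd_self_sub_emod

lemma quo_add_cls {k : ℕ} (hk : 0 < k) {A : Finset ℤ} {i : ℤ} (hi : i ∈ res k A) :
    (quo k A i + cls k A i).card = f k (quo k A i) := by
  rw [f, ← Finset.card_image_of_injective (quo k A i + dil k (quo k A i)) (add_right_injective i)]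
  congr 1
  rw [cls_eq hk hi]
  ext a
  simp only [Finset.mem_image, Finset.mem_add, dil]
  constructor
  · rintro ⟨x, hx, _, ⟨y, hy, rfl⟩, rfl⟩
    exact ⟨x + k * y, ⟨x, hx, _, ⟨y, hy, rfl⟩, rfl⟩, by ring⟩
  · rintro ⟨_, ⟨x, hx, _, ⟨y, hy, rfl⟩, rfl⟩, rfl⟩
    exact ⟨x, hx, _, ⟨y, hy, rfl⟩, by ring⟩

lemma card_two {S S1 S2 : Finset ℤ} (h1 : S1 ⊆ S) (h2 : S2 ⊆ S) (h : Disjoint S1 S2) :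
    S1.card + S2.card ≤ S.card := by
  rw [← Finset.card_union_of_disjoint h]
  exact Finset.card_le_card (Finset.union_subset h1 h2)

lemma cls_subset (k : ℕ) (A : Finset ℤ) (r : ℤ) : cls k A r ⊆ A := Finset.filter_subset _ _

lemma N0 {k : ℕ} (hk : 0 < k) {A : Finset ℤ} {i : ℤ} (hi : i ∈ res k A) :
    f k (quo k A i) ≤ (quo k A i + A).card := by
  rw [← quo_add_cls hk hi]
  exact Finset.card_le_card (Finset.add_subset_add_left (cls_subset _ _ _))

lemma N1 {p α : ℕ} (hp : p.Prime) {A : Finset ℤ} {i l : ℤ} (hi : i ∈ res (p^α) A)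
    (hl : l ∈ res (p^α) A) {γ : ℕ} (hγ : γ ≤ α) (hper : Per p α (quo (p^α) A i) γ)
    (hmin : ∀ γ' < γ, ¬ Per p α (quo (p^α) A i) γ') (hd : ¬ (p:ℤ)^γ ∣ l - i) :
    f (p^α) (quo (p^α) A i) + p^(α-γ) * (cls (p^α) A l).card ≤ (quo (p^α) A i + A).card := by
  have hk : 0 < p ^ α := pow_pos hp.pos α
  have hp0 : (p:ℤ) ≠ 0 := by exact_mod_cast hp.ne_zero
  obtain ⟨x, hx, hxesc⟩ := exists_escape hp hmin hd
  set X := quo (p^α) A i with hX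
  set X' := X.filter (fun y => (p:ℤ)^γ ∣ y - x) with hX'
  have hdvd : (p:ℤ)^γ ∣ ((p^α : ℕ):ℤ) := by push_cast; exact pow_dvd_pow _ hγ
  have hres : p^(α-γ) ≤ (res (p^α) X').card := by
    rw [← Finset.card_range (p^(α-γ))]
    refine Finset.card_le_card_of_injOn (fun z : ℕ => (x + (p:ℤ)^γ * z) % ((p^α:ℕ):ℤ)) ?_ ?_
    · intro z _
      obtain ⟨y, hy, hyd⟩ := hper x hx z
      simp only [Finset.mem_coe, res, Finset.mem_image]
      refine ⟨y, ?_, ?_⟩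
      · rw [hX', Finset.mem_filter]
        refine ⟨hy, ?_⟩
        have e : y - x = (y - (x + (p:ℤ)^γ * z)) + (p:ℤ)^γ * z := by ring
        rw [e]
        exact dvd_add (hdvd.trans hyd) (dvd_mul_right _ _)
      · exact Int.emod_eq_emod_iff_emod_sub_eq_zero.2 (Int.emod_eq_zero_of_dvd hyd)
    · intro z hz w hw h
      have hz' : z < p^(α-γ) := by simpa using hz
      have hw' : w < p^(α-γ) := by simpa using hw
      have h1 := Int.dvd_of_emod_eq_zero (Int.emod_eq_emod_iff_emod_sub_eq_zero.1 h)
      have e : (x + (p:ℤ)^γ * z) - (x + (p:ℤ)^γ * w) = (p:ℤ)^γ * ((z:ℤ) - w) := by ring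
      have e2 : ((p^α : ℕ):ℤ) = (p:ℤ)^γ * ((p^(α-γ) : ℕ) : ℤ) := by
        push_cast; rw [← pow_add]; congr 1; omega
      rw [e, e2, mul_dvd_mul_iff_left (pow_ne_zero _ hp0)] at h1
      have h3 : (z:ℤ) - w = 0 := by
        apply Int.eq_zero_of_abs_lt_dvd h1
        rw [abs_lt]
        constructor <;> omega
      omega
  have hc := card_add_class (p^α) (X := X') (cls_nonempty hl) l (fun b hb => (mem_cls.1 hb).2)
  have hXr : (res (p^α) X').card ≤ X'.card := Finset.card_image_le
  have h1 : p^(α-γ) * (cls (p^α) A l).card ≤ (X' + cls (p^α) A l).card :=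
    (Nat.mul_le_mul_right _ hres).trans (by omega)
  have h2 : (X + cls (p^α) A i).card + (X' + cls (p^α) A l).card ≤ (X + A).card := by
    apply card_two
    · exact Finset.add_subset_add_left (cls_subset _ _ _)
    · exact Finset.add_subset_add (Finset.filter_subset _ _) (cls_subset _ _ _)
    · refine Finset.disjoint_left.2 ?_
      intro a ha ha2
      obtain ⟨y, hy, b, hb, rfl⟩ := Finset.mem_add.1 ha
      obtain ⟨y', hy', c, hc, hh⟩ := Finset.mem_add.1 ha2
      obtain ⟨hy'X, z, hz⟩ := Finset.mem_filter.1 hy'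
      obtain ⟨w, hw, hwd⟩ := hper y hy (-z)
      apply hxesc w hw
      have hb' := dvd_of_mem_cls hb
      have hc' := dvd_of_mem_cls hc
      have e : w - (x + (l - i)) = (w - (y + (p:ℤ)^γ * -z)) + ((c - l) - (b - i)) := by
        linear_combination hz - hh
      rw [e]
      exact dvd_add hwd (dvd_sub hc' hb')
  have h3 := quo_add_cls hk hi
  rw [← hX] at h3
  omega

lemma N2 {p α : ℕ} (hp : p.Prime) {A : Finset ℤ} {r i : ℤ} (hr : r ∈ res (p^α) A)
    {γ : ℕ} (hγ : γ ≤ α) 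
    (h : ∃ x ∈ quo (p^α) A r, ∀ y ∈ quo (p^α) A r, ¬ ((p^γ : ℕ):ℤ) ∣ y - (x + (i - r))) :
    f (p^α) (quo (p^α) A r) + (A.filter (fun a => ((p^γ : ℕ):ℤ) ∣ a - i)).card
      ≤ (quo (p^α) A r + A).card := by
  have hk : 0 < p ^ α := pow_pos hp.pos α
  obtain ⟨x, hx, hxesc⟩ := h
  have hdvd : ((p^γ:ℕ):ℤ) ∣ ((p^α : ℕ):ℤ) := by exact_mod_cast pow_dvd_pow p hγ
  rw [← quo_add_cls hk hr]
  rw [← Finset.card_image_of_injective (A.filter _) (add_right_injective x)]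
  apply card_two
  · exact Finset.add_subset_add_left (cls_subset _ _ _)
  · intro a ha
    obtain ⟨b, hb, rfl⟩ := Finset.mem_image.1 ha
    exact Finset.add_mem_add hx (Finset.mem_filter.1 hb).1
  · refine Finset.disjoint_left.2 ?_
    intro a ha ha2
    obtain ⟨y, hy, b, hb, rfl⟩ := Finset.mem_add.1 ha
    obtain ⟨c, hc, hh⟩ := Finset.mem_image.1 ha2
    apply hxesc y hy
    have hb' := hdvd.trans (dvd_of_mem_cls hb)
    have hc' := (Finset.mem_filter.1 hc).2
    have hh' : x + c = y + b := hh
    have e : y - (x + (i - r)) = (c - i) - (b - r) := by linear_combination - hh'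
    rw [e]
    exact dvd_sub hc' hb'

lemma N3 {q : ℕ} (hq : 0 < q) {A X : Finset ℤ} {i : ℤ}
    (hne : (A.filter (fun a => (q:ℤ) ∣ a - i)).Nonempty)
    (h : ∀ z : ℤ, ∃ y ∈ X, (q:ℤ) ∣ y - z) :
    X.card + q * (A.filter (fun a => (q:ℤ) ∣ a - i)).card ≤ (X + A).card + q := by
  have := card_add_class q (X := X) hne (i % q) (by
    intro b hb
    exact Int.emod_eq_emod_iff_emod_sub_eq_zero.2 (Int.emod_eq_zero_of_dvd (Finset.mem_filter.1 hb).2))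
  rw [res_card_full hq X h] at this
  have h2 : (X + A.filter (fun a => (q:ℤ) ∣ a - i)).card ≤ (X + A).card :=
    Finset.card_le_card (Finset.add_subset_add_left (Finset.filter_subset _ _))
  omega

/-- dichotomy -/
lemma dich {p γ : ℕ} (hp : p.Prime) {X : Finset ℤ} (hX : X.Nonempty) {d : ℤ} (hd : ¬ (p:ℤ) ∣ d) :
    (∃ x ∈ X, ∀ y ∈ X, ¬ ((p^γ : ℕ):ℤ) ∣ y - (x + d)) ∨ ∀ z : ℤ, ∃ y ∈ X, ((p^γ : ℕ):ℤ) ∣ y - z := by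
  by_cases h : ∃ x ∈ X, ∀ y ∈ X, ¬ ((p^γ : ℕ):ℤ) ∣ y - (x + d)
  · exact Or.inl h
  right
  push Not at h
  have hcl := closure (pow_pos hp.pos γ) h
  obtain ⟨x, hx⟩ := hX
  intro z
  have hg : Int.gcd d ((p^γ : ℕ):ℤ) ∣ p ^ γ := by
    have := Int.gcd_dvd_right d ((p^γ : ℕ):ℤ)
    exact_mod_cast this
  obtain ⟨e, he, hge⟩ := (Nat.dvd_prime_pow hp).1 hg
  have he0 : e = 0 := by
    by_contra hne
    apply hd
    have h1 : ((Int.gcd d ((p^γ : ℕ):ℤ) : ℕ) : ℤ) ∣ d := Int.gcd_dvd_left d _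
    rw [hge] at h1
    push_cast at h1
    exact (dvd_pow_self _ hne).trans h1
  obtain ⟨y, hy, hyd⟩ := hcl x hx (z - x) (by rw [hge, he0]; simp)
  exact ⟨y, hy, by simpa using hyd⟩

lemma per_zero {p α : ℕ} (hp : p.Prime) {X : Finset ℤ} (hX : X.Nonempty) (h : Per p α X 0) :
    (res (p^α) X).card = p^α := by
  obtain ⟨x, hx⟩ := hX
  apply res_card_full (pow_pos hp.pos α)
  intro z
  obtain ⟨y, hy, hyd⟩ := h x hx (z - x)
  exact ⟨y, hy, by simpa using hyd⟩

lemma f_affine {k : ℕ} (v c : ℤ) (hc : c ≠ 0) (A : Finset ℤ) :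
    f k (A.image (fun a => v + c * a)) = f k A := by
  have hinj : Function.Injective (fun a : ℤ => (v + k * v) + c * a) := fun x y h =>
    mul_left_cancel₀ hc (add_left_cancel h)
  rw [f, f, ← Finset.card_image_of_injective (A + dil k A) hinj]
  congr 1
  ext a
  simp only [Finset.mem_image, Finset.mem_add, dil]
  constructor
  · rintro ⟨_, ⟨x, hx, rfl⟩, _, ⟨_, ⟨y, hy, rfl⟩, rfl⟩, rfl⟩
    exact ⟨x + k * y, ⟨x, hx, _, ⟨y, hy, rfl⟩, rfl⟩, by ring⟩
  · rintro ⟨_, ⟨x, hx, _, ⟨y, hy, rfl⟩, rfl⟩, rfl⟩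
    exact ⟨_, ⟨x, hx, rfl⟩, _, ⟨_, ⟨y, hy, rfl⟩, rfl⟩, by ring⟩

lemma exists_reduced {p : ℕ} (hp : p.Prime) (k : ℕ) : ∀ n : ℕ, ∀ A : Finset ℤ, ∀ x ∈ A, ∀ y ∈ A,
    x ≠ y → (y - x).natAbs ≤ n →
    ∃ A' : Finset ℤ, A'.card = A.card ∧ f k A' = f k A ∧ ∃ x ∈ A', ∃ y ∈ A', ¬ (p:ℤ) ∣ x - y := by
  have hp0 : (p:ℤ) ≠ 0 := by exact_mod_cast hp.ne_zero
  intro n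
  induction n with
  | zero => 
    intro A x hx y hy hxy h
    omega
  | succ n ih =>
    intro A x hx y hy hxy h
    by_cases hr : ∃ x ∈ A, ∃ y ∈ A, ¬ (p:ℤ) ∣ x - y
    · exact ⟨A, rfl, rfl, hr⟩
    push Not at hr
    set A' := A.image (fun a => (a - x) / (p:ℤ)) with hA'
    have hAA : A = A'.image (fun a => x + p * a) := by
      rw [hA', Finset.image_image]
      symm
      convert Finset.image_id using 1
      apply Finset.image_congr
      intro a ha
      simp only [Function.comp, id]
      rw [Int.mul_ediv_cancel' (hr a ha x hx)]
      ring
    have hcard : A'.card = A.card := by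
      conv_rhs => rw [hAA]
      refine (Finset.card_image_of_injective A' ?_).symm
      exact fun x y h => mul_left_cancel₀ hp0 (add_left_cancel h)
    have hf : f k A' = f k A := by
      conv_rhs => rw [hAA]
      rw [f_affine x p hp0]
    obtain ⟨c, hc⟩ := hr y hy x hx
    have hc0 : c ≠ 0 := by
      rintro rfl
      apply hxy; linarith
    obtain ⟨A'', h1, h2, h3⟩ := ih A' 0 (Finset.mem_image.2 ⟨x, hx, by simp⟩) c
      (Finset.mem_image.2 ⟨y, hy, by rw [hc, Int.mul_ediv_cancel_left _ hp0]⟩) hc0.symm (by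
        rw [hc, Int.natAbs_mul, Int.natAbs_natCast] at h
        have h5 : 1 ≤ c.natAbs := by omega
        have h6 := hp.two_le
        simp only [sub_zero]
        nlinarith)
    exact ⟨A'', h1.trans hcard, h2.trans hf, h3⟩

lemma exists_reduced' {p : ℕ} (hp : p.Prime) (k : ℕ) (A : Finset ℤ) (hA : 2 ≤ A.card) :
    ∃ A' : Finset ℤ, A'.card = A.card ∧ f k A' = f k A ∧ ∃ x ∈ A', ∃ y ∈ A', ¬ (p:ℤ) ∣ x - y := by
  obtain ⟨x, hx, y, hy, hxy⟩ := Finset.one_lt_card.1 hA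
  exact exists_reduced hp k _ A x hx y hy hxy le_rfl

lemma exists_other {p α : ℕ} (hα : 0 < α) {A : Finset ℤ} 
    (h : ∃ x ∈ A, ∃ y ∈ A, ¬ (p:ℤ) ∣ x - y) (i : ℤ) : ∃ r ∈ res (p^α) A, ¬ (p:ℤ) ∣ r - i := by
  obtain ⟨x, hx, y, hy, hxy⟩ := h
  have hd : (p:ℤ) ∣ ((p^α : ℕ):ℤ) := by push_cast; exact dvd_pow_self _ hα.ne'
  by_contra hcon
  push Not at hcon
  have h1 := hcon _ (Finset.mem_image_of_mem _ hx)
  have h2 := hcon _ (Finset.mem_image_of_mem _ hy)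
  have h3 : (p:ℤ) ∣ x - x % ((p^α : ℕ):ℤ) := hd.trans Int.dvd_self_sub_emod
  have h4 : (p:ℤ) ∣ y - y % ((p^α : ℕ):ℤ) := hd.trans Int.dvd_self_sub_emod
  apply hxy
  have := dvd_sub (dvd_add h3 h1) (dvd_add h4 h2)
  simpa using this

set_option maxHeartbeats 1000000 in
lemma weak_step {p α : ℕ} (hp : p.Prime) (hα : 0 < α) {s : ℕ} (hs : 2 ≤ s) (hsk : s ≤ p^α)
    (ih : ∀ B : Finset ℤ, s * B.card ≤ f (p^α) B + (s-1).factorial) (A : Finset ℤ)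
    (hred : ∃ x ∈ A, ∃ y ∈ A, ¬ (p:ℤ) ∣ x - y) :
    (s+1) * A.card ≤ f (p^α) A + s.factorial := by
  classical
  have hk : 0 < p ^ α := pow_pos hp.pos α
  have hAne : A.Nonempty := by
    obtain ⟨x, hx, -⟩ := hred
    exact ⟨x, hx⟩
  have hA1 : 1 ≤ A.card := hAne.card_pos
  rcases le_or_gt s (res (p^α) A).card with hj | hj
  · have h1 := f_ge hk A hAne
    have h2 : s ≤ s.factorial := Nat.self_le_factorial s
    nlinarith
  have hI0 : (res (p^α) A).Nonempty := hAne.image _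
  have hs3 : 3 ≤ s := by
    obtain ⟨i, hi⟩ := hI0
    obtain ⟨r, hr, hri⟩ := exists_other (α := α) hα hred i
    have : 1 < (res (p^α) A).card := Finset.one_lt_card.2 ⟨i, hi, r, hr, by rintro rfl; simp at hri⟩
    omega
  obtain ⟨t, rfl⟩ : ∃ t, s = t + 3 := ⟨s - 3, by omega⟩
  set s := t + 3 with hsdef
  set I := res (p^α) A with hI
  obtain ⟨L, hL⟩ : ∃ L : ℤ, L = (s : ℤ) * ((t+1).factorial : ℤ) := ⟨_, rfl⟩
  have hfac : (1:ℤ) ≤ ((t+1).factorial : ℤ) := by exact_mod_cast Nat.factorial_pos _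
  have hL1 : ((s:ℕ):ℤ) ≤ L := by rw [hL]; nlinarith
  have hfac2 : (((s-1).factorial : ℕ) : ℤ) = ((t:ℤ)+2) * ((t+1).factorial : ℤ) := by
    have : s - 1 = (t+1)+1 := by omega
    rw [this, Nat.factorial_succ]; push_cast; ring
  have hfac3 : ((s.factorial : ℕ) : ℤ) = ((t:ℤ)+2) * L := by
    rw [hsdef, Nat.factorial_succ (t+2), Nat.factorial_succ (t+1), hL, hsdef]; push_cast; ring
  have hscast : ((s:ℕ):ℤ) = (t:ℤ) + 3 := by rw [hsdef]; push_cast; ring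
  have hL2 : (((s-1).factorial : ℕ) : ℤ) ≤ L := by
    rw [hfac2, hL, hscast]; nlinarith
  have hs3' : (3:ℤ) ≤ (s:ℤ) := by exact_mod_cast hs3
  choose γ hγ hper hmin using fun i => exists_per p α (quo (p^α) A i)
  obtain ⟨a, ha⟩ : ∃ a : ℤ → ℤ, ∀ i, a i = ((cls (p^α) A i).card : ℤ) := ⟨_, fun _ => rfl⟩
  obtain ⟨N, hN⟩ : ∃ N : ℤ → ℤ, ∀ i, N i = ((quo (p^α) A i + A).card : ℤ) := ⟨_, fun _ => rfl⟩
  obtain ⟨h, hh⟩ : ∃ h : ℤ → ℤ, ∀ i, h i = ((p^(α - γ i) : ℕ) : ℤ) := ⟨_, fun _ => rfl⟩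
  have ha1 : ∀ i ∈ I, 1 ≤ a i := fun i hi => by
    rw [ha]; exact_mod_cast (cls_nonempty hi).card_pos
  have hh1 : ∀ i, 1 ≤ h i := fun i => by
    rw [hh]; exact_mod_cast Nat.pos_of_ne_zero (pow_ne_zero _ hp.ne_zero)
  have hfN : ∀ i ∈ I, (s:ℤ) * a i - L ≤ (f (p^α) (quo (p^α) A i) : ℤ) := fun i hi => by
    have h1 := ih (quo (p^α) A i)
    rw [card_quo hk hi] at h1
    rw [ha]
    have h2 : (s:ℤ) * ((cls (p^α) A i).card : ℤ) ≤ (f (p^α) (quo (p^α) A i) : ℤ) + ((s-1).factorial : ℕ) := by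
      exact_mod_cast h1
    linarith
  have hE : ∀ i ∈ I, ∀ l ∈ I, ¬ (p:ℤ)^(γ i) ∣ l - i → (s:ℤ) * a i + h i * a l - L ≤ N i := by
    intro i hi l hl hd
    have h1 := N1 hp hi hl (hγ i) (hper i) (hmin i) hd
    have h2 := hfN i hi
    have h3 : (f (p^α) (quo (p^α) A i) : ℤ) + h i * a l ≤ N i := by
      rw [hh, ha, hN]; exact_mod_cast h1
    linarith
  have hF : ∀ i ∈ I, γ i = 0 → ((s:ℤ)+1) * a i - L ≤ N i := by
    intro i hi h0
    have hp0 := hper i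
    rw [h0] at hp0
    have hne : (quo (p^α) A i).Nonempty := quo_nonempty hi
    have h1 := f_ge hk _ hne
    rw [per_zero hp hne hp0, card_quo hk hi] at h1
    have h2 : (f (p^α) (quo (p^α) A i) : ℤ) ≤ N i := by rw [hN]; exact_mod_cast N0 hk hi
    have h3 : a i + ((p^α : ℕ):ℤ) * a i ≤ (f (p^α) (quo (p^α) A i) : ℤ) + ((p^α : ℕ):ℤ) := by
      rw [ha]; exact_mod_cast h1
    have h4 := ha1 i hi
    have h5 : (s:ℤ) ≤ ((p^α : ℕ):ℤ) := by exact_mod_cast hsk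
    nlinarith
  set Bad : Finset ℤ := I.filter (fun i => 0 < γ i ∧ ∀ l ∈ I, ¬ (p:ℤ)^(γ i) ∣ l - i → h i * a l < a i) with hBad
  have hgood : ∀ i ∈ I, i ∉ Bad → ((s:ℤ)+1) * a i - L ≤ N i := by
    intro i hi hb
    rcases Nat.eq_zero_or_pos (γ i) with h0 | h0
    · exact hF i hi h0
    · rw [hBad, Finset.mem_filter] at hb
      push Not at hb
      obtain ⟨l, hl, hd, hle⟩ := hb hi h0
      have := hE i hi l hl hd
      linarith
  have hsumA : ∑ i ∈ I, a i = (A.card : ℤ) := by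
    rw [← sum_cls (p^α) A]; push_cast
    exact Finset.sum_congr rfl fun i _ => ha i
  have hsumN : ∑ i ∈ I, N i = (f (p^α) A : ℤ) := by
    rw [f_decomp hk A]; push_cast
    exact Finset.sum_congr rfl fun i _ => hN i
  have hjL : (I.card : ℤ) * L ≤ ((s.factorial : ℕ) : ℤ) := by
    rw [hfac3]
    have : (I.card : ℤ) ≤ (t:ℤ) + 2 := by omega
    nlinarith
  suffices hsuff : ((s:ℤ)+1) * ∑ i ∈ I, a i - I.card * L ≤ ∑ i ∈ I, N i by
    rw [hsumA, hsumN] at hsuff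
    have : ((s:ℤ)+1) * (A.card : ℤ) ≤ (f (p^α) A : ℤ) + ((s.factorial : ℕ) : ℤ) := by linarith
    exact_mod_cast this
  rcases Finset.eq_empty_or_nonempty Bad with hemp | hne
  · have h1 : ∑ i ∈ I, (((s:ℤ)+1) * a i - L) ≤ ∑ i ∈ I, N i :=
      Finset.sum_le_sum fun i hi => hgood i hi (by rw [hemp]; simp)
    rw [Finset.sum_sub_distrib, ← Finset.mul_sum] at h1
    simpa using h1
  obtain ⟨i0, hi0, hi0min⟩ := Finset.exists_min_image Bad γ hne
  obtain ⟨hi0I, hγ0, hi0l⟩ := Finset.mem_filter.1 hi0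
  have hBU : ∀ i ∈ Bad, (p:ℤ)^(γ i0) ∣ i - i0 := by
    intro i hi
    by_contra hd
    obtain ⟨hiI, -, hil⟩ := Finset.mem_filter.1 hi
    have hd2 : ¬ (p:ℤ)^(γ i) ∣ i0 - i := by
      intro h2
      apply hd
      rw [dvd_sub_comm]
      exact (pow_dvd_pow _ (hi0min i hi)).trans h2
    have h1 := hi0l i hiI hd
    have h2 := hil i0 hi0I hd2
    have := hh1 i; have := hh1 i0; have := ha1 i hiI; have := ha1 i0 hi0I
    nlinarith
  obtain ⟨r, hr, hri⟩ := exists_other (α := α) hα hred i0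
  have hBr : ∀ i ∈ Bad, ¬ (p:ℤ) ∣ r - i := by
    intro i hi h2
    apply hri
    have h3 : (p:ℤ) ∣ i - i0 := (dvd_pow_self _ hγ0.ne').trans (hBU i hi)
    have := dvd_add h2 h3
    simpa using this
  have hrBad : r ∉ Bad := fun hb => hBr r hb (by simp)
  have hBad2 : ∀ i ∈ Bad, (s:ℤ) * a i + h i * a r - L ≤ N i := by
    intro i hi
    obtain ⟨hiI, hpos, hil⟩ := Finset.mem_filter.1 hi
    exact hE i hiI r hr (fun h2 => hBr i hi ((dvd_pow_self _ hpos.ne').trans h2))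
  set q := p ^ (γ i0) with hq
  have hqpos : 0 < q := pow_pos hp.pos _
  set B := A.filter (fun x => (q:ℤ) ∣ x - i0) with hB
  have hSB : ∑ i ∈ Bad, a i ≤ (B.card : ℤ) := by
    have h1 : ∑ i ∈ Bad, (cls (p^α) A i).card ≤ B.card := by
      rw [← Finset.card_biUnion]
      · apply Finset.card_le_card
        intro x hx
        obtain ⟨i, hi, hxi⟩ := Finset.mem_biUnion.1 hx
        rw [hB, Finset.mem_filter]
        refine ⟨cls_subset _ _ _ hxi, ?_⟩
        have h1 := dvd_of_mem_cls hxi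
        have h2 := hBU i hi
        have h3 : (q:ℤ) ∣ ((p^α : ℕ):ℤ) := by exact_mod_cast pow_dvd_pow p (hγ i0)
        have h4 : (q:ℤ) ∣ i - i0 := by rw [hq]; push_cast; exact h2
        have := dvd_add (h3.trans h1) h4
        simpa using this
      · intro i hi l hl hil
        refine Finset.disjoint_left.2 ?_
        intro x hx hx2
        exact hil ((mem_cls.1 hx).2.symm.trans (mem_cls.1 hx2).2)
    calc ∑ i ∈ Bad, a i = ((∑ i ∈ Bad, (cls (p^α) A i).card : ℕ) : ℤ) := by
          push_cast; exact Finset.sum_congr rfl fun i _ => ha i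
      _ ≤ _ := by exact_mod_cast h1
  have hBadI : ∀ i ∈ Bad, i ∈ I := fun i hi => (Finset.mem_filter.1 hi).1
  have hS0 : a i0 ≤ ∑ i ∈ Bad, a i :=
    Finset.single_le_sum (f := a) (fun i hi => by linarith [ha1 i (hBadI i hi)]) hi0
  have hH0 : h i0 ≤ ∑ i ∈ Bad, h i :=
    Finset.single_le_sum (f := h) (fun i hi => by linarith [hh1 i]) hi0
  have hm1 := ha1 r hr
  have hi0r : h i0 * a r < a i0 := hi0l r hr (fun h2 => hri ((dvd_pow_self _ hγ0.ne').trans h2))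
  have hHm : h i0 * a r ≤ (∑ i ∈ Bad, h i) * a r :=
    mul_le_mul_of_nonneg_right hH0 (by linarith)
  have hNr : ((s:ℤ)+1) * a r + (∑ i ∈ Bad, a i - (∑ i ∈ Bad, h i) * a r) - L ≤ N r := by
    have hrne : (quo (p^α) A r).Nonempty := quo_nonempty hr
    have hd' : ¬ (p:ℤ) ∣ i0 - r := by rwa [dvd_sub_comm]
    rcases dich (γ := γ i0) hp hrne hd' with hesc | hfull
    · have h1 := N2 hp hr (hγ i0) hesc
      have h2 : (f (p^α) (quo (p^α) A r) : ℤ) + B.card ≤ N r := by rw [hN]; exact_mod_cast h1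
      have h3 := hfN r hr
      have h4 : 1 * a r ≤ h i0 * a r := mul_le_mul_of_nonneg_right (hh1 i0) (by linarith)
      linarith
    · have hBne : B.Nonempty := by
        rw [← Finset.card_pos]
        have : 1 ≤ a i0 := ha1 i0 hi0I
        have : (0:ℤ) < B.card := by linarith
        exact_mod_cast this
      have h1 := N3 hqpos hBne hfull
      rw [card_quo hk hr] at h1
      have h2 : a r + q * (B.card:ℤ) ≤ N r + q := by rw [ha, hN]; exact_mod_cast h1
      have hqh : (q:ℤ) * h i0 = ((p^α : ℕ):ℤ) := by
        rw [hh, hq]; norm_cast; rw [← pow_add]; congr 1; have := hγ i0; omega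
      have h5 : (s:ℤ) ≤ (q:ℤ) * h i0 := by rw [hqh]; exact_mod_cast hsk
      have h6 : (1:ℤ) ≤ q := by exact_mod_cast hqpos
      have h7 : 0 ≤ ((q:ℤ) - 1) * ((B.card:ℤ) - h i0 * a r - 1) :=
        mul_nonneg (by linarith) (by linarith)
      have h8 : (s:ℤ) * a r ≤ (q:ℤ) * h i0 * a r := mul_le_mul_of_nonneg_right h5 (by linarith)
      linarith
  have hall : ∀ i ∈ I, ((s:ℤ)+1) * a i - L - (if i ∈ Bad then a i - h i * a r else 0)
      + (if i = r then ∑ i ∈ Bad, a i - (∑ i ∈ Bad, h i) * a r else 0) ≤ N i := by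
    intro i hi
    by_cases hir : i = r
    · subst hir
      rw [if_neg hrBad, if_pos rfl]
      linarith
    · rw [if_neg hir]
      by_cases hb : i ∈ Bad
      · rw [if_pos hb]
        have := hBad2 i hb
        linarith
      · rw [if_neg hb]
        have := hgood i hi hb
        linarith
  have hsum := Finset.sum_le_sum hall
  rw [Finset.sum_add_distrib, Finset.sum_sub_distrib, Finset.sum_sub_distrib, ← Finset.mul_sum,
    Finset.sum_ite_eq' I r, if_pos hr, ← Finset.sum_filter] at hsum
  have hfil : I.filter (fun i => i ∈ Bad) = Bad := by
    ext i; rw [Finset.mem_filter]; exact ⟨fun h => h.2, fun h => ⟨hBadI i h, h⟩⟩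
  rw [hfil, Finset.sum_sub_distrib, ← Finset.sum_mul] at hsum
  simp only [Finset.sum_const, nsmul_eq_mul] at hsum
  linarith

lemma weak {p α : ℕ} (hp : p.Prime) (hα : 0 < α) : ∀ s : ℕ, s + 1 ≤ p^α → ∀ B : Finset ℤ,
    (s + 2) * B.card ≤ f (p^α) B + (s+1).factorial := by
  have hk : 0 < p ^ α := pow_pos hp.pos α
  intro s
  induction s with
  | zero =>
    intro _ B
    rcases Finset.eq_empty_or_nonempty B with rfl | hB
    · simp
    · have := card_add_ge hB (B := dil (p^α) B) (hB.image _)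
      rw [dil_card hk] at this
      rw [f]; simp; omega
  | succ s ih =>
    intro hs B
    have ih' := ih (by omega)
    rcases le_or_gt 2 B.card with h2 | h2
    · obtain ⟨A, hA1, hA2, hA3⟩ := exists_reduced' hp (p^α) B h2
      have := weak_step hp hα (s := s + 2) (by omega) (by omega) ih' A hA3
      rw [hA1, hA2] at this
      exact this
    · have h3 := ih' B
      have h4 : s + 1 + 1 ≤ (s+1+1).factorial := Nat.self_le_factorial _
      rcases Nat.lt_or_ge B.card 1 with h0 | h1
      · have : B.card = 0 := by omega
        rw [this]; simp
      · have hB1 : B.card = 1 := by omega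
        have hne : B.Nonempty := Finset.card_pos.1 (by omega)
        have := card_add_ge hne (B := dil (p^α) B) (hne.image _)
        rw [dil_card hk] at this
        have h5 : 1 ≤ f (p^α) B := by rw [f]; omega
        rw [hB1]; omega

lemma count_pairs (I : Finset ℤ) (g : ℤ → ℤ) (hg : ∀ i ∈ I, ∀ l ∈ I, g i = g l → i = l) :
    2 * ∑ i ∈ I, (I.filter (fun l => g i < g l)).card + I.card = I.card * I.card := by
  have h1 : ∑ i ∈ I, (I.filter (fun l => g i < g l)).card = ∑ i ∈ I, (I.filter (fun l => g l < g i)).card :=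
    Finset.sum_card_bipartiteAbove_eq_sum_card_bipartiteBelow (fun i l => g i < g l)
  have h2 : ∀ i ∈ I, (I.filter (fun l => g i < g l)).card + (I.filter (fun l => g l < g i)).card + 1 = I.card := by
    intro i hi
    have e1 : (I.filter (fun l => ¬ g i < g l)) = insert i (I.filter (fun l => g l < g i)) := by
      ext l
      simp only [Finset.mem_filter, Finset.mem_insert]
      constructor
      · rintro ⟨hl, hle⟩
        rcases eq_or_lt_of_le (not_lt.1 hle) with h | h
        · exact Or.inl (hg l hl i hi h)
        · exact Or.inr ⟨hl, h⟩
      · rintro (rfl | ⟨hl, h⟩)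
        · exact ⟨hi, lt_irrefl _⟩
        · exact ⟨hl, not_lt.2 h.le⟩
    have e2 := Finset.card_filter_add_card_filter_not (s := I) (fun l => g i < g l)
    rw [e1, Finset.card_insert_of_notMem (by simp)] at e2
    omega
  have h3 := Finset.sum_congr rfl h2
  rw [Finset.sum_add_distrib, Finset.sum_add_distrib, ← h1] at h3
  simp only [Finset.sum_const, smul_eq_mul, mul_one] at h3
  omega

lemma full_bound {k : ℕ} (hk : 0 < k) (A : Finset ℤ)
    (hfull : ∀ i ∈ res k A, (res k (quo k A i)).card = k) :
    ((k:ℤ)+1) * A.card - (res k A).card * k + (res k A).card * ((res k A).card - 1) ≤ (f k A : ℤ) := by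
  classical
  set I := res k A with hI
  have hM : ∀ i, ∃ M, i ∈ I → M ∈ cls k A i ∧ ∀ b ∈ cls k A i, b ≤ M := by
    intro i
    by_cases hi : i ∈ I
    · exact ⟨(cls k A i).max' (cls_nonempty hi), fun _ => ⟨Finset.max'_mem _ _, fun b hb => Finset.le_max' _ _ hb⟩⟩
    · exact ⟨0, fun h => absurd h hi⟩
  have hm : ∀ i, ∃ M, i ∈ I → M ∈ cls k A i ∧ ∀ b ∈ cls k A i, M ≤ b := by
    intro i
    by_cases hi : i ∈ I
    · exact ⟨(cls k A i).min' (cls_nonempty hi), fun _ => ⟨Finset.min'_mem _ _, fun b hb => Finset.min'_le _ _ hb⟩⟩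
    · exact ⟨0, fun h => absurd h hi⟩
  choose M hM using hM
  choose m hm using hm
  have hMinj : ∀ i ∈ I, ∀ l ∈ I, M i = M l → i = l := by
    intro i hi l hl h
    rw [← (mem_cls.1 (hM i hi).1).2, ← (mem_cls.1 (hM l hl).1).2, h]
  have hminj : ∀ i ∈ I, ∀ l ∈ I, - m i = - m l → i = l := by
    intro i hi l hl h
    rw [← (mem_cls.1 (hm i hi).1).2, ← (mem_cls.1 (hm l hl).1).2, neg_injective h]
  have hNi : ∀ i ∈ I, f k (quo k A i) + ((I.filter (fun l => M i < M l)).card 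
      + (I.filter (fun l => - m i < - m l)).card) ≤ (quo k A i + A).card := by
    intro i hi
    have hne : (quo k A i).Nonempty := quo_nonempty hi
    set xM := (quo k A i).max' hne with hxM
    set xm := (quo k A i).min' hne with hxm
    have hxMm : xM ∈ quo k A i := Finset.max'_mem _ _
    have hxmm : xm ∈ quo k A i := Finset.min'_mem _ _
    have c1 : ((I.filter (fun l => M i < M l)).image (fun l => xM + M l)).card = (I.filter (fun l => M i < M l)).card := by
      apply Finset.card_image_of_injOn
      intro a ha b hb h
      exact hMinj a (Finset.mem_filter.1 ha).1 b (Finset.mem_filter.1 hb).1 (add_left_cancel h)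
    have c2 : ((I.filter (fun l => - m i < - m l)).image (fun l => xm + m l)).card = (I.filter (fun l => - m i < - m l)).card := by
      apply Finset.card_image_of_injOn
      intro a ha b hb h
      exact hminj a (Finset.mem_filter.1 ha).1 b (Finset.mem_filter.1 hb).1 (by rw [add_left_cancel h])
    have hmM : m i ≤ M i := (hM i hi).2 _ (hm i hi).1
    have hxx : xm ≤ xM := Finset.min'_le _ _ hxMm
    rw [← quo_add_cls hk hi, ← c1, ← c2, ← Finset.card_union_of_disjoint]
    · apply card_two
      · exact Finset.add_subset_add_left (cls_subset _ _ _)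
      · apply Finset.union_subset
        · intro a ha
          obtain ⟨l, hl, rfl⟩ := Finset.mem_image.1 ha
          exact Finset.add_mem_add hxMm (cls_subset _ _ _ (hM l (Finset.mem_filter.1 hl).1).1)
        · intro a ha
          obtain ⟨l, hl, rfl⟩ := Finset.mem_image.1 ha
          exact Finset.add_mem_add hxmm (cls_subset _ _ _ (hm l (Finset.mem_filter.1 hl).1).1)
      · refine Finset.disjoint_left.2 ?_
        intro a ha ha2
        obtain ⟨y, hy, b, hb, rfl⟩ := Finset.mem_add.1 ha
        have e1 : y ≤ xM := Finset.le_max' _ _ hy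
        have e2 : xm ≤ y := Finset.min'_le _ _ hy
        have e3 := (hM i hi).2 b hb
        have e4 := (hm i hi).2 b hb
        rcases Finset.mem_union.1 ha2 with h | h
        · obtain ⟨l, hl, hh⟩ := Finset.mem_image.1 h
          have := (Finset.mem_filter.1 hl).2
          have hh' : xM + M l = y + b := hh
          omega
        · obtain ⟨l, hl, hh⟩ := Finset.mem_image.1 h
          have := (Finset.mem_filter.1 hl).2
          have hh' : xm + m l = y + b := hh
          omega
    · refine Finset.disjoint_left.2 ?_
      intro a ha ha2
      obtain ⟨l, hl, rfl⟩ := Finset.mem_image.1 ha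
      obtain ⟨l', hl', hh⟩ := Finset.mem_image.1 ha2
      have := (Finset.mem_filter.1 hl).2
      have := (Finset.mem_filter.1 hl').2
      have hh' : xm + m l' = xM + M l := hh
      omega
  have hNi2 : ∀ i ∈ I, (cls k A i).card + k * (cls k A i).card + ((I.filter (fun l => M i < M l)).card 
      + (I.filter (fun l => - m i < - m l)).card) ≤ (quo k A i + A).card + k := by
    intro i hi
    have h1 := hNi i hi
    have h2 := f_ge hk (quo k A i) (quo_nonempty hi)
    rw [hfull i hi, card_quo hk hi] at h2
    omega
  have hs := Finset.sum_le_sum hNi2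
  rw [Finset.sum_add_distrib, Finset.sum_add_distrib, Finset.sum_add_distrib, Finset.sum_add_distrib,
    ← Finset.mul_sum, hI, sum_cls, ← f_decomp hk, ← hI] at hs
  have p1 := count_pairs I M hMinj
  have p2 := count_pairs I (fun i => - m i) hminj
  simp only [Finset.sum_const, smul_eq_mul] at hs
  have hs' : (A.card:ℤ) + k * A.card + ((∑ i ∈ I, (I.filter (fun l => M i < M l)).card : ℕ) 
      + (∑ i ∈ I, (I.filter (fun l => - m i < - m l)).card : ℕ) : ℤ) ≤ f k A + I.card * k := by exact_mod_cast hs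
  have p1' : 2 * ((∑ i ∈ I, (I.filter (fun l => M i < M l)).card : ℕ) : ℤ) + I.card = I.card * I.card := by
    exact_mod_cast p1
  have p2' : 2 * ((∑ i ∈ I, (I.filter (fun l => - m i < - m l)).card : ℕ) : ℤ) + I.card = I.card * I.card := by
    exact_mod_cast p2
  linarith

lemma ceil_bound (j k : ℤ) : j * (k + 1 - j) ≤ ⌈((k : ℚ) * ((k : ℚ) + 2)) / 4⌉ := by
  have h1 := Int.le_ceil (((k : ℚ) * ((k : ℚ) + 2)) / 4)
  set c := ⌈((k : ℚ) * ((k : ℚ) + 2)) / 4⌉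
  have h2 : (k:ℚ) * (k + 2) ≤ 4 * (c:ℚ) := by linarith
  have h3 : k * (k+2) ≤ 4 * c := by exact_mod_cast h2
  have h4 : 4 * (j * (k+1-j)) ≤ k * (k+2) + 1 := by nlinarith [sq_nonneg (2*j - (k+1))]
  omega

lemma main_reduced {p α : ℕ} (hp : p.Prime) (hα : 0 < α) (A : Finset ℤ)
    (hA : (p^α - 1)^2 * (p^α).factorial ≤ A.card) (hred : ∃ x ∈ A, ∃ y ∈ A, ¬ (p:ℤ) ∣ x - y) :
    ∃ j : ℤ, (((p^α : ℕ):ℤ) + 1) * A.card - j * (((p^α : ℕ):ℤ) + 1 - j) ≤ (f (p^α) A : ℤ) := by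
  classical
  have hk : 0 < p ^ α := pow_pos hp.pos α
  have hk2 : 2 ≤ p ^ α := hp.two_le.trans (Nat.le_self_pow hα.ne' p)
  have hAne : A.Nonempty := by
    obtain ⟨x, hx, -⟩ := hred
    exact ⟨x, hx⟩
  have hw : ∀ B : Finset ℤ, (p^α + 1) * B.card ≤ f (p^α) B + (p^α).factorial := by
    intro B
    have := weak hp hα (p^α - 1) (by omega) B
    rwa [show p^α - 1 + 2 = p^α + 1 by omega, show p^α - 1 + 1 = p^α by omega] at this
  obtain ⟨k, hkdef⟩ : ∃ k, k = p^α := ⟨_, rfl⟩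
  set I := res (p^α) A with hI
  rcases Nat.lt_or_ge I.card (p^α) with hj | hj
  swap
  · have hj' : I.card = p^α := le_antisymm (res_card_le hk A) hj
    have h1 := f_ge hk A hAne
    rw [← hI, hj'] at h1
    refine ⟨((p^α : ℕ):ℤ), ?_⟩
    have : (A.card:ℤ) + ((p^α : ℕ):ℤ) * A.card ≤ f (p^α) A + ((p^α : ℕ):ℤ) := by exact_mod_cast h1
    linarith
  by_cases hfull : ∀ i ∈ I, (res (p^α) (quo (p^α) A i)).card = p^α
  · have := full_bound hk A hfull
    refine ⟨(I.card : ℤ), ?_⟩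
    linarith
  push Not at hfull
  obtain ⟨e, he, hefull⟩ := hfull
  refine ⟨0, ?_⟩
  obtain ⟨L, hL⟩ : ∃ L : ℤ, L = ((p^α).factorial : ℤ) := ⟨_, rfl⟩
  have hL1 : ((p^α : ℕ) : ℤ) ≤ L := by rw [hL]; exact_mod_cast Nat.self_le_factorial _
  choose γ hγ hper hmin using fun i => exists_per p α (quo (p^α) A i)
  obtain ⟨a, ha⟩ : ∃ a : ℤ → ℤ, ∀ i, a i = ((cls (p^α) A i).card : ℤ) := ⟨_, fun _ => rfl⟩
  obtain ⟨N, hN⟩ : ∃ N : ℤ → ℤ, ∀ i, N i = ((quo (p^α) A i + A).card : ℤ) := ⟨_, fun _ => rfl⟩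
  have ha1 : ∀ i ∈ I, 1 ≤ a i := fun i hi => by
    rw [ha]; exact_mod_cast (cls_nonempty hi).card_pos
  have hfN : ∀ i ∈ I, (((p^α : ℕ) : ℤ) + 1) * a i - L ≤ (f (p^α) (quo (p^α) A i) : ℤ) := fun i hi => by
    have h1 := hw (quo (p^α) A i)
    rw [card_quo hk hi] at h1
    rw [ha, hL]
    have h2 : (((p^α : ℕ) : ℤ) + 1) * ((cls (p^α) A i).card : ℤ) ≤ (f (p^α) (quo (p^α) A i) : ℤ) + ((p^α).factorial : ℕ) := by
      exact_mod_cast h1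
    linarith
  have hall : ∀ i ∈ I, (((p^α : ℕ) : ℤ) + 1) * a i - L ≤ N i := fun i hi => by
    have h2 : (f (p^α) (quo (p^α) A i) : ℤ) ≤ N i := by rw [hN]; exact_mod_cast N0 hk hi
    linarith [hfN i hi]
  have hE : ∀ i ∈ I, ∀ l ∈ I, 0 < γ i → ¬ (p:ℤ) ∣ l - i →
      (((p^α : ℕ) : ℤ) + 1) * a i + a l - L ≤ N i := by
    intro i hi l hl h0 hd
    have h1 := N1 hp hi hl (hγ i) (hper i) (hmin i) (fun h2 => hd ((dvd_pow_self _ h0.ne').trans h2))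
    have h2 := hfN i hi
    have h4 : 1 ≤ p^(α - γ i) := Nat.pos_of_ne_zero (pow_ne_zero _ hp.ne_zero)
    have h5 : f (p^α) (quo (p^α) A i) + 1 * (cls (p^α) A l).card ≤ (quo (p^α) A i + A).card :=
      le_trans (Nat.add_le_add_left (Nat.mul_le_mul_right _ h4) _) h1
    rw [one_mul] at h5
    have h3 : (f (p^α) (quo (p^α) A i) : ℤ) + a l ≤ N i := by
      rw [ha, hN]; exact_mod_cast h5
    linarith
  have hsumA : ∑ i ∈ I, a i = (A.card : ℤ) := by
    rw [← sum_cls (p^α) A]; push_cast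
    exact Finset.sum_congr rfl fun i _ => ha i
  have hsumN : ∑ i ∈ I, N i = (f (p^α) A : ℤ) := by
    rw [f_decomp hk A]; push_cast
    exact Finset.sum_congr rfl fun i _ => hN i
  obtain ⟨u, hu, humax⟩ := Finset.exists_max_image I a ⟨e, he⟩
  have hLpos : 0 < L := by have : (0:ℤ) < ((p^α : ℕ):ℤ) := by exact_mod_cast hk
                           linarith
  have hjk : (I.card : ℤ) ≤ ((p^α : ℕ):ℤ) - 1 := by omega
  have hbig : (I.card : ℤ) * L ≤ a u := by
    have h1 : ((p^α : ℕ):ℤ) - 1 ≤ (((p^α - 1 : ℕ)) : ℤ) := by omega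
    have h2 : (((p^α : ℕ):ℤ) - 1)^2 * L ≤ A.card := by
      rw [hL]
      have : ((((p^α - 1)^2 * (p^α).factorial : ℕ)) : ℤ) ≤ A.card := by exact_mod_cast hA
      rw [Nat.cast_mul, Nat.cast_pow, Nat.cast_sub hk] at this
      simpa using this
    have h3 : (A.card : ℤ) ≤ I.card * a u := by
      rw [← hsumA, ← nsmul_eq_mul]
      exact Finset.sum_le_card_nsmul I a (a u) humax
    have h4 : (A.card : ℤ) ≤ (((p^α : ℕ):ℤ) - 1) * a u := by
      have := ha1 u hu
      nlinarith
    have h5 : (0:ℤ) < ((p^α : ℕ):ℤ) - 1 := by omega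
    have h6 : (((p^α : ℕ):ℤ) - 1) * ((((p^α : ℕ):ℤ) - 1) * L) ≤ (((p^α : ℕ):ℤ) - 1) * a u := by
      linarith
    have h7 := le_of_mul_le_mul_left h6 h5
    have h8 := mul_le_mul_of_nonneg_right hjk hLpos.le
    linarith
  have hext : ∃ g : ℤ → ℤ, (∀ i ∈ I, (((p^α : ℕ) : ℤ) + 1) * a i - L + g i ≤ N i) ∧ a u ≤ ∑ i ∈ I, g i := by
    by_cases hcase : ∃ i ∈ I, 0 < γ i ∧ ¬ (p:ℤ) ∣ u - i
    · obtain ⟨i, hi, h0, hd⟩ := hcase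
      refine ⟨fun l => if l = i then a u else 0, ?_, ?_⟩
      · intro l hl
        by_cases hli : l = i
        · subst hli
          simp only [if_true]
          linarith [hE l hl u hu h0 hd]
        · simp only [if_neg hli]
          linarith [hall l hl]
      · rw [Finset.sum_ite_eq', if_pos hi]
    · push Not at hcase
      have he0 : 0 < γ e := by
        rcases Nat.eq_zero_or_pos (γ e) with h0 | h0
        · exfalso
          have := hper e
          rw [h0] at this
          exact hefull (per_zero hp (quo_nonempty he) this)
        · exact h0
      have hue := hcase e he he0
      obtain ⟨r, hr, hru⟩ := exists_other (α := α) hα hred u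
      have hr0 : γ r = 0 := by
        by_contra h0
        apply hru
        rw [dvd_sub_comm]
        exact hcase r hr (Nat.pos_of_ne_zero h0)
      have hre : ¬ (p:ℤ) ∣ r - e := by
        intro h1
        apply hru
        have := dvd_sub h1 hue
        simpa using this
      have hner : r ≠ e := by rintro rfl; simp at hre
      have hNe := hE e he r hr he0 hre
      have hNr : a r + ((p^α : ℕ) : ℤ) * a u - ((p^α : ℕ) : ℤ) ≤ N r := by
        have hp0 := hper r
        rw [hr0] at hp0
        have hne : (quo (p^α) A r).Nonempty := quo_nonempty hr
        have h1 := card_add_class (p^α) (X := quo (p^α) A r) (cls_nonempty hu) u (fun b hb => (mem_cls.1 hb).2)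
        rw [per_zero hp hne hp0, card_quo hk hr] at h1
        have h2 : (quo (p^α) A r + cls (p^α) A u).card ≤ (quo (p^α) A r + A).card :=
          Finset.card_le_card (Finset.add_subset_add_left (cls_subset _ _ _))
        have h3 : (cls (p^α) A r).card + p^α * (cls (p^α) A u).card ≤ (quo (p^α) A r + A).card + p^α := by omega
        have h4 : a r + ((p^α : ℕ) : ℤ) * a u ≤ N r + ((p^α : ℕ) : ℤ) := by
          rw [ha, ha, hN]; exact_mod_cast h3
        linarith
      refine ⟨fun l => (if l = e then a r else 0) + (if l = r then ((p^α : ℕ) : ℤ) * (a u - a r) else 0), ?_, ?_⟩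
      · intro l hl
        by_cases hle : l = e
        · subst hle
          simp only [if_true, if_neg hner.symm]
          linarith
        · by_cases hlr : l = r
          · subst hlr
            simp only [if_true, if_neg hle]
            linarith
          · simp only [if_neg hle, if_neg hlr]
            linarith [hall l hl]
      · rw [Finset.sum_add_distrib, Finset.sum_ite_eq', Finset.sum_ite_eq', if_pos he, if_pos hr]
        have h1 := humax r hr
        have h2 : (1:ℤ) ≤ ((p^α : ℕ) : ℤ) := by exact_mod_cast hk
        have h3 := mul_le_mul_of_nonneg_right h2 (sub_nonneg.2 h1)
        linarith
  obtain ⟨g, hg1, hg2⟩ := hext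
  have hs := Finset.sum_le_sum hg1
  rw [Finset.sum_add_distrib, Finset.sum_sub_distrib, ← Finset.mul_sum, hsumA, hsumN] at hs
  simp only [Finset.sum_const, nsmul_eq_mul] at hs
  linarith

end SD

/-- Let `p` be a prime, `α` a positive integer, and `k = p^α`. Let `A` be a finite set of
integers with `|A| ≥ (k−1)²·k!`. Then `|A + k·A| ≥ (k+1)|A| − ⌈k(k+2)/4⌉`. -/
theorem stmt_0 (p : ℕ) (hp : p.Prime) (α : ℕ) (hα : 0 < α) (k : ℕ) (hk : k = p ^ α)
    (A : Finset ℤ) (hA : (k - 1) ^ 2 * Nat.factorial k ≤ A.card) :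
    ((k : ℤ) + 1) * A.card - ⌈((k : ℚ) * ((k : ℚ) + 2)) / 4⌉ ≤
      ((A + A.image (fun b => (k : ℤ) * b)).card : ℤ) := by
  subst hk
  have hk2 : 2 ≤ p ^ α := hp.two_le.trans (Nat.le_self_pow hα.ne' p)
  have hA2 : 2 ≤ A.card := by
    refine le_trans ?_ hA
    have h1 : 2 ≤ (p^α).factorial := hk2.trans (Nat.self_le_factorial _)
    have h2 : 1 ≤ (p^α - 1)^2 := Nat.one_le_pow _ _ (by omega)
    nlinarith
  obtain ⟨A', h1, h2, h3⟩ := SD.exists_reduced' hp (p^α) A hA2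
  obtain ⟨j, hj⟩ := SD.main_reduced hp hα A' (by rw [h1]; exact hA) h3
  rw [h1, h2] at hj
  have hc := SD.ceil_bound j ((p^α : ℕ) : ℤ)
  have hf : (SD.f (p^α) A : ℤ) = ((A + A.image (fun b => ((p^α : ℕ) : ℤ) * b)).card : ℤ) := rfl
  rw [← hf]
  rw [Int.cast_natCast] at hc
  linarith
end

section
/- Let p₁ and p₂ be distinct primes and k = p₁p₂. Let A be a finite set of integers with |A| ≥ (k−1)²·k!. Then |A + k·A| ≥ (k+1)|A| − ⌈k(k+2)/4⌉. -/
open Finset Pointwise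

/-- The combinatorial data attached to a normalised set and its residue classes. -/
structure Geo (p q k : ℤ) (I : Finset ℤ) (x f g c a b wa wb : ℤ → ℤ)
    (Ta Tb Fa Fb : ℤ → Prop) : Prop where
  hp : 2 ≤ p
  hq : 2 ≤ q
  hk : k = p * q
  pos : ∀ i ∈ I, 1 ≤ x i
  gf : ∀ i ∈ I, g i ≤ f i
  hF : ∀ i ∈ I, ∀ h ∈ I, x i + c i * (x h - 1) ≤ f i
  hT : ∀ i ∈ I, c i = k ∨ (∀ h ∈ I, h ≠ i → g i + x h ≤ f i) ∨ Ta i ∨ Tb i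
  ha : ∀ i ∈ I, Ta i → ∀ h ∈ I, a h ≠ a i → g i + p * x h ≤ f i
  hb : ∀ i ∈ I, Tb i → ∀ h ∈ I, b h ≠ b i → g i + q * x h ≤ f i
  aF : ∀ i ∈ I, Ta i → Fb i ∧ ¬ Fa i
  bF : ∀ i ∈ I, Tb i → Fa i ∧ ¬ Fb i
  nFa : ∀ i ∈ I, ¬ Fa i → ∀ h ∈ I, a h ≠ a i → g i + wa h ≤ f i
  nFb : ∀ i ∈ I, ¬ Fb i → ∀ h ∈ I, b h ≠ b i → g i + wb h ≤ f i
  yFa : ∀ i ∈ I, Fa i → ∀ h ∈ I, x i + q * (wa h - 1) ≤ f i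
  yFb : ∀ i ∈ I, Fb i → ∀ h ∈ I, x i + p * (wb h - 1) ≤ f i
  sa : ∀ S ⊆ I, ∀ h ∈ I, (∀ i ∈ S, a i = a h) → ∑ i ∈ S, x i ≤ wa h
  sb : ∀ S ⊆ I, ∀ h ∈ I, (∀ i ∈ S, b i = b h) → ∑ i ∈ S, x i ≤ wb h
  inj : ∀ i ∈ I, ∀ h ∈ I, a i = a h → b i = b h → i = h
  ea : ∀ i ∈ I, ∃ h ∈ I, a h ≠ a i
  eb : ∀ i ∈ I, ∃ h ∈ I, b h ≠ b i

section
variable {p q k : ℤ} {I : Finset ℤ} {x f g c a b wa wb : ℤ → ℤ}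
    {Ta Tb Fa Fb : ℤ → Prop}

theorem Geo.swap (G : Geo p q k I x f g c a b wa wb Ta Tb Fa Fb) :
    Geo q p k I x f g c b a wb wa Tb Ta Fb Fa :=
  { hp := G.hq, hq := G.hp, hk := by rw [G.hk]; ring, pos := G.pos, gf := G.gf, hF := G.hF,
    hT := fun i hi => by have := G.hT i hi; tauto
    ha := G.hb, hb := G.ha, aF := G.bF, bF := G.aF, nFa := G.nFb, nFb := G.nFa,
    yFa := G.yFb, yFb := G.yFa, sa := G.sb, sb := G.sa,
    inj := fun i hi h hh h1 h2 => G.inj i hi h hh h2 h1, ea := G.eb, eb := G.ea }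

/-- Key part of the sharp step. -/
theorem Geo.sharp_aux (G : Geo p q k I x f g c a b wa wb Ta Tb Fa Fb) (L : ℤ) (hL : k ≤ L)
    (hg : ∀ i ∈ I, (k + 1) * x i - L ≤ g i)
    (o : ℤ) (ho : o ∈ I) (hmax : ∀ i ∈ I, x i ≤ x o)
    (e : ℤ) (he : e ∈ I) (hTe : Ta e) (hae : a e = a o) :
    ∃ h ∈ I, h ≠ e ∧ x o ≤ (f e + L - (k + 1) * x e) + (f h + L - (k + 1) * x h) := by
  obtain ⟨h, hh, hne⟩ := G.ea o ho
  have hp := G.hp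
  have hq := G.hq
  have hk := G.hk
  have hneE : h ≠ e := by rintro rfl; exact hne hae
  have hneo : h ≠ o := by rintro rfl; exact hne rfl
  refine ⟨h, hh, hneE, ?_⟩
  have h1 := G.ha e he hTe h hh (by rw [hae]; exact hne)
  have h2 := hg e he
  have h3 := hg h hh
  have h4 := G.gf h hh
  have hm := hmax h hh
  have hxh := G.pos h hh
  have hue : p * x h ≤ f e + L - (k + 1) * x e := by linarith
  have hk4 : 4 ≤ k := by nlinarith
  rcases G.hT h hh with hc | hc | hc | hc
  · have h5 := G.hF h hh o ho
    rw [hc] at h5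
    nlinarith
  · have h5 := hc o ho hneo.symm
    nlinarith
  · have h5 := G.ha h hh hc o ho hne.symm
    nlinarith
  · by_cases hle : x o ≤ p * x h
    · linarith
    · push Not at hle
      have h5 := G.yFa h hh (G.bF h hh hc).1 o ho
      have h6 := G.sa {o} (by simpa using ho) o ho (by simp)
      simp at h6
      have h7 : q ≤ k := by nlinarith
      have h8 : 0 ≤ (q - 1) * (x o - p * x h) := by
        apply mul_nonneg <;> linarith
      have h9 : q * x o ≤ q * wa o := by
        apply mul_le_mul_of_nonneg_left h6; linarith
      subst hk
      nlinarith

theorem Geo.sharp (G : Geo p q k I x f g c a b wa wb Ta Tb Fa Fb) (L : ℤ) (hL : k ≤ L)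
    (hg : ∀ i ∈ I, (k + 1) * x i - L ≤ g i)
    (o : ℤ) (ho : o ∈ I) (hmax : ∀ i ∈ I, x i ≤ x o)
    (e : ℤ) (he : e ∈ I) (hce : c e ≠ k) :
    x o ≤ ∑ i ∈ I, (f i + L - (k + 1) * x i) := by
  have hp := G.hp
  have hq := G.hq
  have hk := G.hk
  have hu0 : ∀ i ∈ I, 0 ≤ f i + L - (k + 1) * x i := fun i hi => by
    have := hg i hi; have := G.gf i hi; linarith
  have one : ∀ i ∈ I, x o ≤ f i + L - (k + 1) * x i →
      x o ≤ ∑ i ∈ I, (f i + L - (k + 1) * x i) := fun i hi h =>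
    h.trans (Finset.single_le_sum (f := fun i => f i + L - (k + 1) * x i) hu0 hi)
  have two : ∀ i ∈ I, ∀ h ∈ I, h ≠ i →
      x o ≤ (f i + L - (k + 1) * x i) + (f h + L - (k + 1) * x h) →
      x o ≤ ∑ i ∈ I, (f i + L - (k + 1) * x i) := fun i hi h hh hne hle => by
    refine hle.trans ?_
    rw [← Finset.sum_pair (f := fun i => f i + L - (k + 1) * x i) hne.symm]
    apply Finset.sum_le_sum_of_subset_of_nonneg
    · intro z hz
      simp at hz
      rcases hz with rfl | rfl <;> assumption
    · intro z hz _; exact hu0 z hz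
  have xo := G.pos o ho
  by_cases hA : ∃ e ∈ I, Ta e ∧ a e = a o
  · obtain ⟨e, he, h1, h2⟩ := hA
    obtain ⟨h, hh, hne, hle⟩ := G.sharp_aux L hL hg o ho hmax e he h1 h2
    exact two e he h hh hne hle
  by_cases hB : ∃ e ∈ I, Tb e ∧ b e = b o
  · obtain ⟨e, he, h1, h2⟩ := hB
    obtain ⟨h, hh, hne, hle⟩ := G.swap.sharp_aux L hL hg o ho hmax e he h1 h2
    exact two e he h hh hne hle
  push Not at hA hB
  have key : ∀ i ∈ I, i ≠ o → c i ≠ k → x o ≤ f i + L - (k + 1) * x i := by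
    intro i hi hio hc
    have h2 := hg i hi
    rcases G.hT i hi with h | h | h | h
    · exact absurd h hc
    · have := h o ho hio.symm
      linarith
    · have := G.ha i hi h o ho (hA i hi h).symm
      nlinarith
    · have := G.hb i hi h o ho (hB i hi h).symm
      nlinarith
  by_cases heo : e = o
  · subst heo
    obtain ⟨h, hh, hne⟩ := G.ea e he
    have hne' : h ≠ e := by rintro rfl; exact hne rfl
    by_cases hch : c h = k
    · rcases G.hT e he with h1 | h1 | h1 | h1
      · exact absurd h1 hce
      · refine two e he h hh hne' ?_
        have h2 := h1 h hh hne'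
        have h3 := G.hF h hh e he
        rw [hch] at h3
        have h4 := hg e he
        have h5 := hmax h hh
        have hk4 : 4 ≤ k := by nlinarith
        nlinarith
      · exact absurd rfl (hA e he h1)
      · exact absurd rfl (hB e he h1)
    · exact one h hh (key h hh hne' hch)
  · exact one e he (key e he heo hce)

/-- Balancing lemma, first form. -/
theorem Geo.bal (G : Geo p q k I x f g c a b wa wb Ta Tb Fa Fb) (s L : ℤ)
    (hsk : s ≤ k) (hL : 1 ≤ L) (hg : ∀ i ∈ I, s * x i - L ≤ g i)
    (o : ℤ) (ho : o ∈ I) (h : ℤ) (hh : h ∈ I) (hne : a h ≠ a o)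
    (S : Finset ℤ) (hS : S ⊆ I) (hSn : S.Nonempty)
    (hSa : ∀ i ∈ S, a i = a o) (hST : ∀ i ∈ S, Ta i) (hSx : ∀ i ∈ S, p * x h < x i) :
    0 ≤ ∑ i ∈ S, (f i + L - (s + 1) * x i) + (f h + L - (s + 1) * x h) := by
  have hp := G.hp
  have hq := G.hq
  have hk := G.hk
  have hm := G.pos h hh
  have h1 : ∑ i ∈ S, (p * x h - x i) ≤ ∑ i ∈ S, (f i + L - (s + 1) * x i) := by
    apply Finset.sum_le_sum
    intro i hi
    have := G.ha i (hS hi) (hST i hi) h hh (by rw [hSa i hi]; exact hne)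
    have := hg i (hS hi)
    linarith
  have h2 : ∑ i ∈ S, (p * x h + 1) ≤ ∑ i ∈ S, x i :=
    Finset.sum_le_sum fun i hi => by have := hSx i hi; linarith
  rw [Finset.sum_sub_distrib] at h1
  simp only [Finset.sum_const, nsmul_eq_mul] at h1 h2
  have h3 := G.sa S hS o ho hSa
  have hd : (1 : ℤ) ≤ S.card := by exact_mod_cast hSn.card_pos
  set w := ∑ i ∈ S, x i
  set d : ℤ := (S.card : ℤ)
  set m := x h
  have hpm : 2 ≤ p * m := by nlinarith
  have hdpm : p * m ≤ d * (p * m) := by nlinarith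
  by_cases hF : Fa h
  · have h4 := G.yFa h hh hF o ho
    have h5 : q * w ≤ q * wa o := mul_le_mul_of_nonneg_left h3 (by linarith)
    have h6 : (q - 1) * (d * (p * m + 1)) ≤ (q - 1) * w :=
      mul_le_mul_of_nonneg_left h2 (by linarith)
    have h7 : s * m ≤ k * m := mul_le_mul_of_nonneg_right hsk (by linarith)
    have h8 : q * (p * m) ≤ d * (q * (p * m)) := by nlinarith
    have h9 : q - 1 ≤ (q - 1) * d := by nlinarith
    subst hk
    nlinarith
  · have h4 := G.nFa h hh hF o ho hne.symm
    have h5 := hg h hh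
    have : m ≤ p * m := by nlinarith
    linarith

/-- Balancing lemma, second form, with an additional index `o`. -/
theorem Geo.bal' (G : Geo p q k I x f g c a b wa wb Ta Tb Fa Fb) (s L : ℤ)
    (hsk : s ≤ k) (hL : 1 ≤ L) (hg : ∀ i ∈ I, s * x i - L ≤ g i)
    (o : ℤ) (ho : o ∈ I) (h : ℤ) (hh : h ∈ I) (hne : a h ≠ a o)
    (S : Finset ℤ) (hS : S ⊆ I) (hSn : S.Nonempty)
    (hSa : ∀ i ∈ S, a i = a o) (hST : ∀ i ∈ S, Ta i) (hSx : ∀ i ∈ S, p * x h < x i)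
    (hoS : o ∉ S) (hox : p * x h < x o) :
    0 ≤ (f o + L - (s + 1) * x o) +
      (∑ i ∈ S, (f i + L - (s + 1) * x i) + (f h + L - (s + 1) * x h)) := by
  have hp := G.hp
  have hq := G.hq
  have hk := G.hk
  have hm := G.pos h hh
  have h0 : - x o ≤ f o + L - (s + 1) * x o := by
    have := hg o ho; have := G.gf o ho; linarith
  have h1 : ∑ i ∈ S, (p * x h - x i) ≤ ∑ i ∈ S, (f i + L - (s + 1) * x i) := by
    apply Finset.sum_le_sum
    intro i hi
    have := G.ha i (hS hi) (hST i hi) h hh (by rw [hSa i hi]; exact hne)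
    have := hg i (hS hi)
    linarith
  have h2 : ∑ i ∈ S, (p * x h + 1) ≤ ∑ i ∈ S, x i :=
    Finset.sum_le_sum fun i hi => by have := hSx i hi; linarith
  rw [Finset.sum_sub_distrib] at h1
  simp only [Finset.sum_const, nsmul_eq_mul] at h1 h2
  have h3 := G.sa (insert o S) (Finset.insert_subset ho hS) o ho (by
    intro i hi
    rcases Finset.mem_insert.1 hi with rfl | hi
    · rfl
    · exact hSa i hi)
  rw [Finset.sum_insert hoS] at h3
  have hd : (1 : ℤ) ≤ S.card := by exact_mod_cast hSn.card_pos
  set w := ∑ i ∈ S, x i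
  set d : ℤ := (S.card : ℤ)
  set m := x h
  have hpm : 2 ≤ p * m := by nlinarith
  have hdpm : p * m ≤ d * (p * m) := by nlinarith
  by_cases hF : Fa h
  · have h4 := G.yFa h hh hF o ho
    have h5 : q * (x o + w) ≤ q * wa o := mul_le_mul_of_nonneg_left h3 (by linarith)
    have h6 : (q - 1) * (d * (p * m + 1)) ≤ (q - 1) * w :=
      mul_le_mul_of_nonneg_left h2 (by linarith)
    have h6' : (q - 1) * (p * m + 1) ≤ (q - 1) * x o :=
      mul_le_mul_of_nonneg_left (by linarith) (by linarith)
    have h7 : s * m ≤ k * m := mul_le_mul_of_nonneg_right hsk (by linarith)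
    have h8 : q * (p * m) ≤ d * (q * (p * m)) := by nlinarith
    have h9 : q - 1 ≤ (q - 1) * d := by nlinarith
    have h10 : 0 ≤ (q - 1) * (p * m) := by apply mul_nonneg <;> linarith
    subst hk
    nlinarith
  · have h4 := G.nFa h hh hF o ho hne.symm
    have h5 := hg h hh
    have : m ≤ p * m := by nlinarith
    linarith

theorem split_sum {I T : Finset ℤ} {u : ℤ → ℤ} (hT : T ⊆ I) (h : 0 ≤ ∑ i ∈ T, u i)
    (h' : ∀ i ∈ I, i ∉ T → 0 ≤ u i) : 0 ≤ ∑ i ∈ I, u i :=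
  h.trans (Finset.sum_le_sum_of_subset_of_nonneg hT h')

/-- Indices different from the maximal one which are not bad are fine. -/
theorem Geo.sat (G : Geo p q k I x f g c a b wa wb Ta Tb Fa Fb) (s L : ℤ) (hs : 1 ≤ s)
    (hsk : s ≤ k) (hL : s ≤ L) (hg : ∀ i ∈ I, s * x i - L ≤ g i)
    (o : ℤ) (ho : o ∈ I) (hmax : ∀ i ∈ I, x i ≤ x o) (i : ℤ) (hi : i ∈ I)
    (hio : i ≠ o) :
    x o - x i ≤ f i + L - (s + 1) * x i ∨ (Ta i ∧ a i = a o) ∨ (Tb i ∧ b i = b o) := by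
  have hp := G.hp
  have hq := G.hq
  have xo := G.pos o ho
  have hm := hmax i hi
  have h2 := hg i hi
  by_cases hc : s ≤ c i
  · left
    have h1 := G.hF i hi o ho
    have h3 : s * (x o - 1) ≤ c i * (x o - 1) := mul_le_mul_of_nonneg_right hc (by linarith)
    nlinarith
  · rcases G.hT i hi with h | h | h | h
    · exact absurd (h ▸ hsk) hc
    · left; have := h o ho hio.symm; linarith
    · by_cases e : a i = a o
      · exact Or.inr (Or.inl ⟨h, e⟩)
      · left; have := G.ha i hi h o ho (Ne.symm e); nlinarith
    · by_cases e : b i = b o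
      · exact Or.inr (Or.inr ⟨h, e⟩)
      · left; have := G.hb i hi h o ho (Ne.symm e); nlinarith

theorem Geo.sato (G : Geo p q k I x f g c a b wa wb Ta Tb Fa Fb) (s L : ℤ) (hs : 1 ≤ s)
    (hsk : s ≤ k) (hL : s ≤ L) (hg : ∀ i ∈ I, s * x i - L ≤ g i)
    (o : ℤ) (ho : o ∈ I) :
    0 ≤ f o + L - (s + 1) * x o ∨
      (∀ h ∈ I, h ≠ o → x h - x o ≤ f o + L - (s + 1) * x o) ∨ Ta o ∨ Tb o := by
  have xo := G.pos o ho
  have h2 := hg o ho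
  by_cases hc : s ≤ c o
  · left
    have h1 := G.hF o ho o ho
    have h3 : s * (x o - 1) ≤ c o * (x o - 1) := mul_le_mul_of_nonneg_right hc (by linarith)
    nlinarith
  · rcases G.hT o ho with h | h | h | h
    · exact absurd (h ▸ hsk) hc
    · right; left; intro h' hh' hne; have := h h' hh' hne; linarith
    · exact Or.inr (Or.inr (Or.inl h))
    · exact Or.inr (Or.inr (Or.inr h))

/-- Bad indices of the first kind only. -/
theorem Geo.weak1 (G : Geo p q k I x f g c a b wa wb Ta Tb Fa Fb) (s L : ℤ) (hs : 1 ≤ s)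
    (hsk : s ≤ k) (hL : s ≤ L) (hg : ∀ i ∈ I, s * x i - L ≤ g i)
    (o : ℤ) (ho : o ∈ I) (hmax : ∀ i ∈ I, x i ≤ x o)
    (h₁ : ℤ) (hh₁ : h₁ ∈ I) (hne₁ : a h₁ ≠ a o)
    (h₂ : ℤ) (hh₂ : h₂ ∈ I) (hne₂ : b h₂ ≠ b o)
    (e : ℤ) (he : e ∈ I) (heT : Ta e) (hea : a e = a o) (hex : p * x h₁ < x e)
    (hB2 : ∀ i ∈ I, Tb i → b i = b o → x i ≤ q * x h₂) :
    0 ≤ ∑ i ∈ I, (f i + L - (s + 1) * x i) := by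
  classical
  set S := I.filter (fun i => Ta i ∧ a i = a o ∧ p * x h₁ < x i) with hSdef
  have hS : S ⊆ I := Finset.filter_subset _ _
  have hSn : S.Nonempty := ⟨e, by simp [hSdef, *]⟩
  have hSa : ∀ i ∈ S, a i = a o := fun i hi => (Finset.mem_filter.1 hi).2.2.1
  have hST : ∀ i ∈ S, Ta i := fun i hi => (Finset.mem_filter.1 hi).2.1
  have hSx : ∀ i ∈ S, p * x h₁ < x i := fun i hi => (Finset.mem_filter.1 hi).2.2.2
  have hox : p * x h₁ < x o := hex.trans_le (hmax e he)
  have h1S : h₁ ∉ S := fun h => hne₁ (hSa _ h)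
  have h1o : h₁ ≠ o := by rintro rfl; exact hne₁ rfl
  have good : ∀ i ∈ I, i ∉ S → i ≠ o → 0 ≤ f i + L - (s + 1) * x i := by
    intro i hi hiS hio
    have hm := hmax i hi
    have h2 := hg i hi
    rcases G.sat s L hs hsk hL hg o ho hmax i hi hio with h | ⟨h, h'⟩ | ⟨h, h'⟩
    · linarith
    · have : ¬ p * x h₁ < x i := fun hlt => hiS (by simp [hSdef, *])
      have h3 := G.ha i hi h h₁ hh₁ (by rw [h']; exact hne₁)
      linarith
    · have h3 := G.hb i hi h h₂ hh₂ (by rw [h']; exact hne₂)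
      have := hB2 i hi h h'
      linarith
  by_cases hoS : o ∈ S ∨ 0 ≤ f o + L - (s + 1) * x o
  · apply split_sum (T := insert h₁ S) (Finset.insert_subset hh₁ hS)
    · rw [Finset.sum_insert h1S, add_comm]
      exact G.bal s L hsk (by linarith) hg o ho h₁ hh₁ hne₁ S hS hSn hSa hST hSx
    · intro i hi hiS
      simp only [Finset.mem_insert, not_or] at hiS
      by_cases hio : i = o
      · subst hio
        rcases hoS with h | h
        · exact absurd h hiS.2
        · exact h
      · exact good i hi hiS.2 hio
  · push Not at hoS
    apply split_sum (T := insert o (insert h₁ S))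
      (Finset.insert_subset ho (Finset.insert_subset hh₁ hS))
    · rw [Finset.sum_insert (by simp [hoS.1, h1o.symm]), Finset.sum_insert h1S,
        add_comm (f h₁ + L - (s + 1) * x h₁)]
      exact G.bal' s L hsk (by linarith) hg o ho h₁ hh₁ hne₁ S hS hSn hSa hST hSx hoS.1 hox
    · intro i hi hiS
      simp only [Finset.mem_insert, not_or] at hiS
      exact good i hi hiS.2.2 hiS.1

/-- Bad indices of both kinds, the maximal one being of the first kind. -/
theorem Geo.weak2 (G : Geo p q k I x f g c a b wa wb Ta Tb Fa Fb) (s L : ℤ) (hs : 1 ≤ s)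
    (hsk : s ≤ k) (hL : s ≤ L) (hg : ∀ i ∈ I, s * x i - L ≤ g i)
    (o : ℤ) (ho : o ∈ I) (hmax : ∀ i ∈ I, x i ≤ x o)
    (h₁ : ℤ) (hh₁ : h₁ ∈ I) (hne₁ : a h₁ ≠ a o) (hm₁ : ∀ i ∈ I, a i ≠ a o → x i ≤ x h₁)
    (h₂ : ℤ) (hh₂ : h₂ ∈ I) (hne₂ : b h₂ ≠ b o) (hm₂ : ∀ i ∈ I, b i ≠ b o → x i ≤ x h₂)
    (hoT : Ta o) (hox : p * x h₁ < x o)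
    (e : ℤ) (he : e ∈ I) (heT : Tb e) (heb : b e = b o) (hex : q * x h₂ < x e) :
    0 ≤ ∑ i ∈ I, (f i + L - (s + 1) * x i) := by
  classical
  have hp := G.hp
  have hq := G.hq
  have noTT : ∀ i ∈ I, Ta i → Tb i → False := fun i hi h h' => (G.aF i hi h).2 (G.bF i hi h').1
  have heo : e ≠ o := by rintro rfl; exact noTT _ he hoT heT
  have hea : a e ≠ a o := fun h => heo (G.inj _ he _ ho h heb)
  have h1b : b h₁ = b o := by
    by_contra hc
    have h1 := hm₂ h₁ hh₁ hc
    have h2 := hm₁ e he hea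
    have := G.pos h₂ hh₂
    nlinarith
  set S := I.filter (fun i => Tb i ∧ b i = b o ∧ q * x h₂ < x i ∧ i ≠ h₁) with hSdef
  have hS : S ⊆ I := Finset.filter_subset _ _
  have hSa : ∀ i ∈ S, b i = b o := fun i hi => (Finset.mem_filter.1 hi).2.2.1
  have hST : ∀ i ∈ S, Tb i := fun i hi => (Finset.mem_filter.1 hi).2.1
  have hSx : ∀ i ∈ S, q * x h₂ < x i := fun i hi => (Finset.mem_filter.1 hi).2.2.2.1
  have h1S : h₁ ∉ S := fun h => (Finset.mem_filter.1 h).2.2.2.2 rfl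
  have hoS : o ∉ S := fun h => noTT _ ho hoT (hST _ h)
  have h2S : h₂ ∉ S := fun h => hne₂ (hSa _ h)
  have h1o : h₁ ≠ o := by rintro rfl; exact hne₁ rfl
  have h2o : h₂ ≠ o := by rintro rfl; exact hne₂ rfl
  have h12 : h₁ ≠ h₂ := by rintro rfl; exact hne₂ h1b
  have good : ∀ i ∈ I, i ∉ S → i ≠ o → i ≠ h₁ → 0 ≤ f i + L - (s + 1) * x i := by
    intro i hi hiS hio hi1
    have hm := hmax i hi
    have h2 := hg i hi
    rcases G.sat s L hs hsk hL hg o ho hmax i hi hio with h | ⟨h, h'⟩ | ⟨h, h'⟩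
    · linarith
    · have hbi : b i ≠ b o := fun hb => hio (G.inj _ hi _ ho h' hb)
      have h3 := G.ha i hi h e he (by rw [h']; exact hea)
      have h4 := hm₂ i hi hbi
      have := G.pos h₂ hh₂
      have := G.pos e he
      nlinarith
    · have : ¬ q * x h₂ < x i := fun hlt => hiS (by simp [hSdef, *])
      have h3 := G.hb i hi h h₂ hh₂ (by rw [h']; exact hne₂)
      linarith
  have b1 := G.bal s L hsk (by linarith) hg o ho h₁ hh₁ hne₁ {o} (by simpa using ho) (by simp)
    (by simp) (by simpa using hoT) (by simpa using hox)
  rw [Finset.sum_singleton] at b1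
  by_cases hSn : S.Nonempty
  · have b2 := G.swap.bal s L hsk (by linarith) hg o ho h₂ hh₂ hne₂ S hS hSn hSa hST hSx
    apply split_sum (T := insert o (insert h₁ (insert h₂ S)))
      (Finset.insert_subset ho (Finset.insert_subset hh₁ (Finset.insert_subset hh₂ hS)))
    · rw [Finset.sum_insert (by simp [hoS, h1o.symm, h2o.symm]),
        Finset.sum_insert (by simp [h12, h1S]), Finset.sum_insert h2S]
      linarith
    · intro i hi hiS
      simp only [Finset.mem_insert, not_or] at hiS
      exact good i hi hiS.2.2.2 hiS.1 hiS.2.1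
  · apply split_sum (T := {o, h₁}) (by intro z hz; simp at hz; rcases hz with rfl | rfl <;> assumption)
    · rw [Finset.sum_pair h1o.symm]; exact b1
    · intro i hi hiS
      simp only [Finset.mem_insert, Finset.mem_singleton, not_or] at hiS
      exact good i hi (fun h => hSn ⟨i, h⟩) hiS.1 hiS.2

/-- No bad indices; the maximal index has trivial stabiliser. -/
theorem Geo.weak3 (G : Geo p q k I x f g c a b wa wb Ta Tb Fa Fb) (s L : ℤ) (hs : 1 ≤ s)
    (hsk : s ≤ k) (hL : s ≤ L)
    (o : ℤ) (ho : o ∈ I)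
    (h₁ : ℤ) (hh₁ : h₁ ∈ I) (h1o : h₁ ≠ o)
    (h₂ : ℤ) (hh₂ : h₂ ∈ I) (h2o : h₂ ≠ o) (h12 : h₁ ≠ h₂)
    (hg : ∀ i ∈ I, s * x i - L ≤ g i)
    (h0 : ∀ h ∈ I, h ≠ o → x h - x o ≤ f o + L - (s + 1) * x o)
    (good : ∀ i ∈ I, i ≠ o → 0 ≤ f i + L - (s + 1) * x i)
    (hT₁ : Tb h₁) (hT₂ : Ta h₂) (hae : a h₂ = a o) (hne : a h₁ ≠ a o)
    (hle : x h₂ ≤ x h₁) :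
    0 ≤ ∑ i ∈ I, (f i + L - (s + 1) * x i) := by
  have hp := G.hp
  have hq := G.hq
  have hk := G.hk
  apply split_sum (T := {o, h₁, h₂})
  · intro z hz; simp at hz; rcases hz with rfl | rfl | rfl <;> assumption
  · rw [Finset.sum_insert (by simp [h1o.symm, h2o.symm]), Finset.sum_pair h12]
    have e1 := h0 h₁ hh₁ h1o
    have e2 := G.ha h₂ hh₂ hT₂ h₁ hh₁ (by rw [hae]; exact hne)
    have e2' := hg h₂ hh₂
    have e3 := good h₁ hh₁ h1o
    have m1 := G.pos h₁ hh₁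
    have m2 := G.pos h₂ hh₂
    by_cases hn : x o ≤ p * x h₁
    · linarith
    · push Not at hn
      have e4 := G.yFa h₁ hh₁ (G.bF h₁ hh₁ hT₁).1 o ho
      have e5 := G.sa {o, h₂} (by intro z hz; simp at hz; rcases hz with rfl | rfl <;> assumption)
        o ho (by intro z hz; simp at hz; rcases hz with rfl | rfl <;> simp [hae])
      rw [Finset.sum_pair h2o.symm] at e5
      have e6 : q * (x o + x h₂) ≤ q * wa o := mul_le_mul_of_nonneg_left e5 (by linarith)
      have e7 : (q - 1) * (p * x h₁ + 1) ≤ (q - 1) * x o :=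
        mul_le_mul_of_nonneg_left (by linarith) (by linarith)
      have e8 : s * x h₁ ≤ k * x h₁ := mul_le_mul_of_nonneg_right hsk (by linarith)
      have e9 : 0 ≤ (q - 1) * x h₂ := mul_nonneg (by linarith) (by linarith)
      subst hk
      nlinarith
  · intro i hi hiS
    simp only [Finset.mem_insert, not_or] at hiS
    exact good i hi hiS.1

theorem Geo.weak (G : Geo p q k I x f g c a b wa wb Ta Tb Fa Fb) (s L : ℤ) (hs : 1 ≤ s)
    (hsk : s ≤ k) (hL : s ≤ L) (hg : ∀ i ∈ I, s * x i - L ≤ g i) :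
    0 ≤ ∑ i ∈ I, (f i + L - (s + 1) * x i) := by
  classical
  rcases I.eq_empty_or_nonempty with rfl | hI
  · simp
  have hp := G.hp
  have hq := G.hq
  obtain ⟨o, ho, hmax⟩ := I.exists_max_image x hI
  obtain ⟨h₁, hh₁', hm₁'⟩ := (I.filter (fun i => a i ≠ a o)).exists_max_image x (by
    obtain ⟨h, hh, hne⟩ := G.ea o ho
    exact ⟨h, by simp [hh, hne]⟩)
  obtain ⟨h₂, hh₂', hm₂'⟩ := (I.filter (fun i => b i ≠ b o)).exists_max_image x (by
    obtain ⟨h, hh, hne⟩ := G.eb o ho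
    exact ⟨h, by simp [hh, hne]⟩)
  simp only [Finset.mem_filter] at hh₁' hh₂' hm₁' hm₂'
  obtain ⟨hh₁, hne₁⟩ := hh₁'
  obtain ⟨hh₂, hne₂⟩ := hh₂'
  have hm₁ : ∀ i ∈ I, a i ≠ a o → x i ≤ x h₁ := fun i hi h => hm₁' i ⟨hi, h⟩
  have hm₂ : ∀ i ∈ I, b i ≠ b o → x i ≤ x h₂ := fun i hi h => hm₂' i ⟨hi, h⟩
  by_cases hB1 : ∃ e ∈ I, Ta e ∧ a e = a o ∧ p * x h₁ < x e
  · obtain ⟨e, he, heT, hea, hex⟩ := hB1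
    by_cases hB2 : ∃ e ∈ I, Tb e ∧ b e = b o ∧ q * x h₂ < x e
    · obtain ⟨e', he', heT', heb', hex'⟩ := hB2
      by_cases heo : e = o
      · subst heo
        exact G.weak2 s L hs hsk hL hg e ho hmax h₁ hh₁ hne₁ hm₁ h₂ hh₂ hne₂ hm₂ heT hex
          e' he' heT' heb' hex'
      · by_cases heo' : e' = o
        · subst heo'
          exact G.swap.weak2 s L hs hsk hL hg e' ho hmax h₂ hh₂ hne₂ hm₂ h₁ hh₁ hne₁ hm₁ heT' hex'
            e he heT hea hex
        · exfalso
          have e1 := hm₂ e he (fun h => heo (G.inj _ he _ ho hea h))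
          have e2 := hm₁ e' he' (fun h => heo' (G.inj _ he' _ ho h heb'))
          have := G.pos h₁ hh₁
          have := G.pos h₂ hh₂
          nlinarith
    · push Not at hB2
      exact G.weak1 s L hs hsk hL hg o ho hmax h₁ hh₁ hne₁ h₂ hh₂ hne₂ e he heT hea hex hB2
  push Not at hB1
  by_cases hB2 : ∃ e ∈ I, Tb e ∧ b e = b o ∧ q * x h₂ < x e
  · obtain ⟨e', he', heT', heb', hex'⟩ := hB2
    exact G.swap.weak1 s L hs hsk hL hg o ho hmax h₂ hh₂ hne₂ h₁ hh₁ hne₁ e' he' heT' heb' hex' hB1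
  push Not at hB2
  have good : ∀ i ∈ I, i ≠ o → 0 ≤ f i + L - (s + 1) * x i := by
    intro i hi hio
    have hm := hmax i hi
    have h2 := hg i hi
    rcases G.sat s L hs hsk hL hg o ho hmax i hi hio with h | ⟨h, h'⟩ | ⟨h, h'⟩
    · linarith
    · have h3 := G.ha i hi h h₁ hh₁ (by rw [h']; exact hne₁)
      have := hB1 i hi h h'
      linarith
    · have h3 := G.hb i hi h h₂ hh₂ (by rw [h']; exact hne₂)
      have := hB2 i hi h h'
      linarith
  have triv : 0 ≤ f o + L - (s + 1) * x o → 0 ≤ ∑ i ∈ I, (f i + L - (s + 1) * x i) := by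
    intro h
    apply Finset.sum_nonneg
    intro i hi
    by_cases hio : i = o
    · subst hio; exact h
    · exact good i hi hio
  have h1o : h₁ ≠ o := by rintro rfl; exact hne₁ rfl
  have h2o : h₂ ≠ o := by rintro rfl; exact hne₂ rfl
  have h2 := hg o ho
  rcases G.sato s L hs hsk hL hg o ho with h | h0 | h | h
  · exact triv h
  · have pair : ∀ h ∈ I, h ≠ o → x o - x h ≤ f h + L - (s + 1) * x h →
        0 ≤ ∑ i ∈ I, (f i + L - (s + 1) * x i) := by
      intro h hh hho hu
      apply split_sum (T := {o, h})
        (by intro z hz; simp at hz; rcases hz with rfl | rfl <;> assumption)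
      · rw [Finset.sum_pair hho.symm]; have := h0 h hh hho; linarith
      · intro i hi hiS
        simp only [Finset.mem_insert, not_or] at hiS
        exact good i hi hiS.1
    rcases G.sat s L hs hsk hL hg o ho hmax h₁ hh₁ h1o with h | ⟨h, h'⟩ | ⟨h, h'⟩
    · exact pair h₁ hh₁ h1o h
    · exact absurd h' hne₁
    · rcases G.sat s L hs hsk hL hg o ho hmax h₂ hh₂ h2o with h3 | ⟨h3, h3'⟩ | ⟨h3, h3'⟩
      · exact pair h₂ hh₂ h2o h3
      · have h12 : h₁ ≠ h₂ := by rintro rfl; exact hne₁ h3'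
        rcases le_total (x h₂) (x h₁) with hle | hle
        · exact G.weak3 s L hs hsk hL o ho h₁ hh₁ h1o h₂ hh₂ h2o h12 hg h0 good h h3 h3' hne₁ hle
        · exact G.swap.weak3 s L hs hsk hL o ho h₂ hh₂ h2o h₁ hh₁ h1o h12.symm hg h0 good h3 h h'
            hne₂ hle
      · exact absurd h3' hne₂
  · apply triv
    have h3 := G.ha o ho h h₁ hh₁ hne₁
    have := hB1 o ho h rfl
    linarith
  · apply triv
    have h3 := G.hb o ho h h₂ hh₂ hne₂
    have := hB2 o ho h rfl
    linarith
end

theorem dvd_cast {k u v : ℤ} (h : k ∣ u) (e : v = u) : k ∣ v := e ▸ h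

/-- Elements of `A` in the residue class `i` modulo `q`. -/
def cls (A : Finset ℤ) (q i : ℤ) : Finset ℤ := A.filter (fun z => z % q = i)

/-- The rescaled residue class. -/
def Xs (A : Finset ℤ) (k i : ℤ) : Finset ℤ := (cls A k i).image (fun z => z / k)

/-- Residues of `X` modulo `k` are invariant under translation by `d`. -/
def Per (X : Finset ℤ) (k d : ℤ) : Prop := ∀ x ∈ X, ∃ y ∈ X, k ∣ y - x - d

/-- `X` meets all residue classes modulo `q`. -/
def Ful (X : Finset ℤ) (q : ℤ) : Prop := ∀ z : ℤ, ∃ x ∈ X, q ∣ x - z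

theorem mem_cls {A : Finset ℤ} {q i z : ℤ} : z ∈ cls A q i ↔ z ∈ A ∧ z % q = i := by
  simp [cls]

theorem mem_Xs {A : Finset ℤ} {k i z : ℤ} (hk : 0 < k) (hi : 0 ≤ i) (hik : i < k) :
    z ∈ Xs A k i ↔ k * z + i ∈ A := by
  simp only [Xs, Finset.mem_image, mem_cls]
  constructor
  · rintro ⟨y, ⟨hy, h1⟩, rfl⟩
    rw [← h1, Int.mul_ediv_add_emod]; exact hy
  · intro h
    refine ⟨k * z + i, ⟨h, ?_⟩, ?_⟩
    · rw [Int.mul_add_emod_self_left, Int.emod_eq_of_lt hi hik]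
    · rw [Int.mul_add_ediv_left _ _ hk.ne', Int.ediv_eq_zero_of_lt hi hik, add_zero]

theorem card_Xs (A : Finset ℤ) (k i : ℤ) : (Xs A k i).card = (cls A k i).card := by
  apply Finset.card_image_of_injOn
  intro y hy z hz h
  simp only [Finset.mem_coe, mem_cls] at hy hz
  simp only at h
  rw [← Int.mul_ediv_add_emod y k, ← Int.mul_ediv_add_emod z k, h, hy.2, hz.2]

/-- Lower bound through residue classes. -/
theorem class_bound (X B : Finset ℤ) (q : ℤ) (hB : B.Nonempty)
    (hBq : ∀ y ∈ B, ∀ z ∈ B, q ∣ y - z) :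
    (X.card : ℤ) + ((X.image (fun z => z % q)).card : ℤ) * ((B.card : ℤ) - 1) ≤ (X + B).card := by
  obtain ⟨b₀, hb₀⟩ := hB
  set S := X.image (fun z => z % q) with hS
  have h1 : ∑ c ∈ S, ((cls X q c).card + B.card - 1) ≤ (X + B).card := by
    calc ∑ c ∈ S, ((cls X q c).card + B.card - 1)
        ≤ ∑ c ∈ S, (cls X q c + B).card := by
          apply Finset.sum_le_sum
          intro c hc
          apply cauchy_davenport_add_of_linearOrder_isCancelAdd
          · obtain ⟨z, hz, rfl⟩ := Finset.mem_image.1 hc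
            exact ⟨z, mem_cls.2 ⟨hz, rfl⟩⟩
          · exact ⟨b₀, hb₀⟩
      _ = (S.biUnion (fun c => cls X q c + B)).card := by
          rw [Finset.card_biUnion]
          intro c _ d _ hcd
          rw [Function.onFun, Finset.disjoint_left]
          intro z hz hz'
          obtain ⟨y, hy, b, hb, rfl⟩ := Finset.mem_add.1 hz
          obtain ⟨y', hy', b', hb', he⟩ := Finset.mem_add.1 hz'
          apply hcd
          rw [← (mem_cls.1 hy).2, ← (mem_cls.1 hy').2]
          apply Int.emod_eq_emod_iff_emod_sub_eq_zero.2
          apply Int.emod_eq_zero_of_dvd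
          exact dvd_cast (hBq b' hb' b hb) (by linarith)
      _ ≤ (X + B).card := by
          apply Finset.card_le_card
          intro z hz
          obtain ⟨c, _, hz⟩ := Finset.mem_biUnion.1 hz
          obtain ⟨y, hy, b, hb, rfl⟩ := Finset.mem_add.1 hz
          exact Finset.add_mem_add (mem_cls.1 hy).1 hb
  have h2 : X.card = ∑ c ∈ S, (cls X q c).card := Finset.card_eq_sum_card_image _ _
  have hb : 1 ≤ B.card := Finset.card_pos.2 ⟨b₀, hb₀⟩
  have h3 : ∑ c ∈ S, ((cls X q c).card + B.card - 1) = X.card + S.card * (B.card - 1) := by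
    rw [h2]
    have : ∀ c ∈ S, (cls X q c).card + B.card - 1 = (cls X q c).card + (B.card - 1) := by
      intro c _; omega
    rw [Finset.sum_congr rfl this, Finset.sum_add_distrib]
    simp
  rw [h3] at h1
  have : ((X.card + S.card * (B.card - 1) : ℕ) : ℤ) ≤ (X + B).card := by exact_mod_cast h1
  push_cast [Nat.cast_sub hb] at this
  exact this

theorem Ful.card {X : Finset ℤ} {q : ℤ} (hq : 0 < q) (h : Ful X q) :
    ((X.image (fun z => z % q)).card : ℤ) = q := by
  have : X.image (fun z => z % q) = Finset.Ico 0 q := by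
    ext z
    simp only [Finset.mem_image, Finset.mem_Ico]
    constructor
    · rintro ⟨y, _, rfl⟩
      exact ⟨Int.emod_nonneg _ hq.ne', Int.emod_lt_of_pos _ hq⟩
    · rintro ⟨h0, h1⟩
      obtain ⟨y, hy, hd⟩ := h z
      refine ⟨y, hy, ?_⟩
      rw [Int.emod_eq_emod_iff_emod_sub_eq_zero.2 (Int.emod_eq_zero_of_dvd hd),
        Int.emod_eq_of_lt h0 h1]
  rw [this]; simp [hq.le]

theorem card_Ful {X : Finset ℤ} {q : ℤ} (hq : 0 < q)
    (h : q ≤ ((X.image (fun z => z % q)).card : ℤ)) : Ful X q := by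
  have hsub : X.image (fun z => z % q) ⊆ Finset.Ico 0 q := by
    intro z
    simp only [Finset.mem_image, Finset.mem_Ico]
    rintro ⟨y, _, rfl⟩
    exact ⟨Int.emod_nonneg _ hq.ne', Int.emod_lt_of_pos _ hq⟩
  have heq := Finset.eq_of_subset_of_card_le hsub (by simp; omega)
  intro z
  have : z % q ∈ X.image (fun z => z % q) := by
    rw [heq]; simp [Int.emod_nonneg _ hq.ne', Int.emod_lt_of_pos _ hq]
  obtain ⟨y, hy, he⟩ := Finset.mem_image.1 this
  exact ⟨y, hy, Int.dvd_of_emod_eq_zero (Int.emod_eq_emod_iff_emod_sub_eq_zero.1 he)⟩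

theorem card_res_le (X : Finset ℤ) {q : ℤ} (hq : 0 < q) :
    ((X.image (fun z => z % q)).card : ℤ) ≤ q := by
  have hsub : X.image (fun z => z % q) ⊆ Finset.Ico 0 q := by
    intro z
    simp only [Finset.mem_image, Finset.mem_Ico]
    rintro ⟨y, _, rfl⟩
    exact ⟨Int.emod_nonneg _ hq.ne', Int.emod_lt_of_pos _ hq⟩
  have := Finset.card_le_card hsub
  simp at this
  omega

theorem Per.add {X : Finset ℤ} {k d e : ℤ} (h : Per X k d) (h' : Per X k e) : Per X k (d + e) := by
  intro x hx
  obtain ⟨y, hy, h1⟩ := h x hx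
  obtain ⟨z, hz, h2⟩ := h' y hy
  exact ⟨z, hz, dvd_cast (dvd_add h1 h2) (by ring)⟩

theorem Per.nmul {X : Finset ℤ} {k d : ℤ} (h : Per X k d) (n : ℕ) : Per X k (n * d) := by
  induction n with
  | zero => intro x hx; exact ⟨x, hx, by simp⟩
  | succ n ih => have := ih.add h; convert this using 1; push_cast; ring

theorem Per.congr {X : Finset ℤ} {k d e : ℤ} (h : Per X k d) (hd : k ∣ d - e) : Per X k e := by
  intro x hx
  obtain ⟨y, hy, h1⟩ := h x hx
  exact ⟨y, hy, dvd_cast (dvd_add h1 hd) (by ring)⟩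

theorem Per.mul {X : Finset ℤ} {k d : ℤ} (hk : 0 < k) (h : Per X k d) (n : ℤ) :
    Per X k (n * d) := by
  have h1 := h.nmul (n % k).toNat
  apply h1.congr
  rw [Int.toNat_of_nonneg (Int.emod_nonneg _ hk.ne'), ← sub_mul]
  apply Dvd.dvd.mul_right
  exact ⟨-(n / k), by have := Int.mul_ediv_add_emod n k; linarith⟩

theorem Per.gcd {X : Finset ℤ} {k d : ℤ} (hk : 0 < k) (h : Per X k d) (e : ℤ)
    (he : (Int.gcd d k : ℤ) ∣ e) : Per X k e := by
  obtain ⟨t, rfl⟩ := he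
  apply (h.mul hk (t * Int.gcdA d k)).congr
  rw [Int.gcd_eq_gcd_ab d k]
  exact ⟨- (t * Int.gcdB d k), by ring⟩

theorem Per.ful {X : Finset ℤ} {k : ℤ} (hX : X.Nonempty) (h : ∀ e, Per X k e) : Ful X k := by
  obtain ⟨x, hx⟩ := hX
  intro z
  obtain ⟨y, hy, hd⟩ := h (z - x) x hx
  exact ⟨y, hy, by convert hd using 1; ring⟩

/-- No proper set of residues modulo a prime is periodic. -/
theorem Per.prime {X : Finset ℤ} {p : ℕ} (hp : p.Prime) (hX : X.Nonempty) {d : ℤ}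
    (h : Per X p d) (hd : ¬ (p : ℤ) ∣ d) : Ful X p := by
  apply Per.ful hX
  intro e
  apply h.gcd (by exact_mod_cast hp.pos)
  have : Int.gcd d p = 1 := by
    rw [Int.gcd_comm, Int.isCoprime_iff_gcd_eq_one.1]
    exact (Nat.prime_iff_prime_int.1 hp).coprime_iff_not_dvd.2 hd
  rw [this]; simp

theorem Per.two {X : Finset ℤ} {p q : ℕ} (hp : p.Prime) (hq : q.Prime) {d : ℤ}
    (h : Per X (p * q) d) (hd : ¬ (p * q : ℤ) ∣ d) : Per X (p * q) p ∨ Per X (p * q) q := by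
  have hk : (0 : ℤ) < p * q := by exact_mod_cast Nat.mul_pos hp.pos hq.pos
  by_contra! hc
  have h1 : ¬ ((Int.gcd d (p * q) : ℕ) : ℤ) ∣ p := fun h' => hc.1 (h.gcd hk _ h')
  have h2 : ¬ ((Int.gcd d (p * q) : ℕ) : ℤ) ∣ q := fun h' => hc.2 (h.gcd hk _ h')
  have h3 : Int.gcd d (p * q) ∣ p * q := by
    have := Int.gcd_dvd_right d (p * q); exact_mod_cast this
  have h4 := Int.gcd_dvd_left d (p * q)
  obtain ⟨u, v, hu, hv, huv⟩ := (Nat.dvd_mul).1 h3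
  rw [← huv] at h1 h2 h4
  rcases (Nat.dvd_prime hp).1 hu with rfl | rfl <;> rcases (Nat.dvd_prime hq).1 hv with rfl | rfl
  · simp at h1
  · simp at h2
  · simp at h1
  · exact hd (by exact_mod_cast h4)

/-- Gaining new elements. -/
theorem gain (X A B : Finset ℤ) (D : Finset ℤ) (hB : B ⊆ A) (hD : D ⊆ X + A)
    (hdis : ∀ z ∈ D, z ∉ X + B) : (X + B).card + D.card ≤ (X + A).card := by
  rw [← Finset.card_union_of_disjoint (Finset.disjoint_right.2 hdis)]
  exact Finset.card_le_card (Finset.union_subset (Finset.add_subset_add_left hB) hD)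

/-- A single new translate. -/
theorem gain_one {X A B B' : Finset ℤ} {k i h : ℤ} (hB : B ⊆ A) (hB' : B' ⊆ A)
    (hBi : ∀ z ∈ B, k ∣ z - i) (hBh : ∀ z ∈ B', k ∣ z - h) (hP : ¬ Per X k (h - i)) :
    ((X + B).card : ℤ) + B'.card ≤ (X + A).card := by
  simp only [Per, not_forall, not_exists, not_and] at hP
  obtain ⟨x, hx, hn⟩ := hP
  have := gain X A B (B'.image (fun z => x + z)) hB (by
    intro z hz
    obtain ⟨y, hy, rfl⟩ := Finset.mem_image.1 hz
    exact Finset.add_mem_add hx (hB' hy)) (by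
    intro z hz hz'
    obtain ⟨y, hy, rfl⟩ := Finset.mem_image.1 hz
    obtain ⟨x', hx', b, hb, he⟩ := Finset.mem_add.1 hz'
    apply hn x' hx'
    have h1 := hBi b hb
    have h2 := hBh y hy
    exact dvd_cast (dvd_sub h2 h1) (by linarith))
  rw [Finset.card_image_of_injective _ (add_right_injective x)] at this
  exact_mod_cast this

/-- Many new translates. -/
theorem gain_many {X A B B' : Finset ℤ} {k p q i h : ℤ} (hk : k = p * q) (hp : 0 < p)
    (hq : 0 < q) (hB : B ⊆ A) (hB' : B' ⊆ A)
    (hBi : ∀ z ∈ B, q ∣ z - i) (hBh : ∀ z ∈ B', k ∣ z - h) (hP : ¬ Per X q (h - i))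
    (hper : Per X k q) :
    ((X + B).card : ℤ) + p * B'.card ≤ (X + A).card := by
  have hk0 : 0 < k := hk ▸ mul_pos hp hq
  simp only [Per, not_forall, not_exists, not_and] at hP
  obtain ⟨x, hx, hn⟩ := hP
  have hex : ∀ t : ℤ, ∃ y ∈ X, k ∣ y - x - t * q := fun t => hper.mul hk0 t x hx
  choose y hyX hyd using hex
  have hyq : ∀ t, q ∣ y t - x := by
    intro t
    have h1 : q ∣ y t - x - t * q := (Dvd.intro_left p hk.symm).trans (hyd t)
    exact dvd_cast (dvd_add h1 (Dvd.intro_left t rfl : q ∣ t * q)) (by ring)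
  set D := ((Finset.Ico 0 p) ×ˢ B').image (fun z => y z.1 + z.2) with hDdef
  have hcard : (D.card : ℤ) = p * B'.card := by
    rw [hDdef, Finset.card_image_of_injOn]
    · rw [Finset.card_product]; simp [hp.le]
    · rintro ⟨t, b⟩ h1 ⟨t', b'⟩ h2 he
      simp only [Finset.coe_product, Set.mem_prod, Finset.mem_coe, Finset.mem_Ico] at h1 h2
      simp only at he
      have e1 := hyd t
      have e2 := hyd t'
      have e3 := hBh b h1.2
      have e4 := hBh b' h2.2
      have e5 : k ∣ (t - t') * q := by
        exact dvd_cast (dvd_sub (dvd_sub e2 e1) (dvd_sub e3 e4)) (by linear_combination he)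
      rw [hk] at e5
      have e6 : p ∣ t - t' := Int.dvd_of_mul_dvd_mul_right hq.ne' e5
      have e7 : t - t' = 0 := by
        apply Int.eq_zero_of_abs_lt_dvd e6
        rw [abs_lt]; constructor <;> linarith [h1.1.1, h1.1.2, h2.1.1, h2.1.2]
      have e8 : t = t' := by linarith
      subst e8
      simp at he
      rw [he]
  have := gain X A B D hB (by
    intro z hz
    obtain ⟨⟨t, b⟩, hy, rfl⟩ := Finset.mem_image.1 hz
    exact Finset.add_mem_add (hyX t) (hB' (Finset.mem_product.1 hy).2)) (by
    intro z hz hz'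
    obtain ⟨⟨t, b⟩, hy, rfl⟩ := Finset.mem_image.1 hz
    obtain ⟨x', hx', b', hb', he⟩ := Finset.mem_add.1 hz'
    apply hn x' hx'
    have h1 := hBi b' hb'
    have h2 : q ∣ b - h := (Dvd.intro_left p hk.symm).trans (hBh b (Finset.mem_product.1 hy).2)
    simp only at he
    exact dvd_cast (dvd_add (dvd_sub h2 h1) (hyq t)) (by linarith))
  have : ((X + B).card : ℤ) + D.card ≤ (X + A).card := by exact_mod_cast this
  rw [hcard] at this
  exact this

theorem card_scale (A B : Finset ℤ) (k i : ℤ) (hk : 0 < k) :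
    (Xs A k i + B).card = (cls A k i + B.image (fun b => k * b)).card := by
  have : cls A k i + B.image (fun b => k * b) = (Xs A k i + B).image (fun z => k * z + i) := by
    ext z
    simp only [Finset.mem_add, Finset.mem_image, Xs]
    constructor
    · rintro ⟨y, hy, _, ⟨b, hb, rfl⟩, rfl⟩
      refine ⟨y / k + b, ⟨y / k, ⟨y, hy, rfl⟩, b, hb, rfl⟩, ?_⟩
      have h1 := Int.mul_ediv_add_emod y k
      rw [(mem_cls.1 hy).2] at h1
      linear_combination h1
    · rintro ⟨_, ⟨_, ⟨y, hy, rfl⟩, b, hb, rfl⟩, rfl⟩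
      refine ⟨y, hy, k * b, ⟨b, hb, rfl⟩, ?_⟩
      have h1 := Int.mul_ediv_add_emod y k
      rw [(mem_cls.1 hy).2] at h1
      linear_combination -h1
  rw [this, Finset.card_image_of_injective]
  intro y z h
  simpa [hk.ne'] using h

theorem card_sum (A : Finset ℤ) (k : ℤ) (hk : 0 < k) :
    (A + A.image (fun b => k * b)).card =
      ∑ i ∈ A.image (fun z => z % k), (Xs A k i + A).card := by
  have hmap : ((A + A.image (fun b => k * b) : Finset ℤ) : Set ℤ).MapsTo (fun z => z % k)
      (A.image (fun z => z % k) : Finset ℤ) := by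
    intro z hz
    obtain ⟨y, hy, w, hw, rfl⟩ := Finset.mem_add.1 (Finset.mem_coe.1 hz)
    obtain ⟨b, hb, rfl⟩ := Finset.mem_image.1 hw
    refine Finset.mem_coe.2 (Finset.mem_image.2 ⟨y, hy, ?_⟩)
    simp
  rw [Finset.card_eq_sum_card_fiberwise hmap]
  apply Finset.sum_congr rfl
  intro i _
  rw [card_scale A A k i hk]
  congr 1
  ext z
  simp only [Finset.mem_filter, Finset.mem_add, Finset.mem_image, mem_cls]
  constructor
  · rintro ⟨⟨y, hy, _, ⟨b, hb, rfl⟩, rfl⟩, h⟩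
    exact ⟨y, ⟨hy, by simpa using h⟩, k * b, ⟨b, hb, rfl⟩, rfl⟩
  · rintro ⟨y, ⟨hy, h⟩, _, ⟨b, hb, rfl⟩, rfl⟩
    exact ⟨⟨y, hy, k * b, ⟨b, hb, rfl⟩, rfl⟩, by simpa using h⟩

theorem sum_cls (A : Finset ℤ) (k : ℤ) :
    ∑ i ∈ A.image (fun z => z % k), ((Xs A k i).card : ℤ) = A.card := by
  rw [Finset.card_eq_sum_card_image (fun z => z % k) A]
  push_cast
  apply Finset.sum_congr rfl
  intro i _
  rw [card_Xs]; rfl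

theorem sum_cls_le (A S : Finset ℤ) (k q h : ℤ) (hqk : q ∣ k)
    (hS : ∀ i ∈ S, i % q = h % q) :
    ∑ i ∈ S, ((Xs A k i).card : ℤ) ≤ (cls A q (h % q)).card := by
  have h1 : ∑ i ∈ S, (Xs A k i).card ≤ (cls A q (h % q)).card := by
    simp only [card_Xs]
    rw [← Finset.card_biUnion]
    · apply Finset.card_le_card
      intro z hz
      obtain ⟨i, hi, hz⟩ := Finset.mem_biUnion.1 hz
      obtain ⟨hz1, hz2⟩ := mem_cls.1 hz
      refine mem_cls.2 ⟨hz1, ?_⟩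
      rw [← hS i hi, ← hz2, Int.emod_emod_of_dvd _ hqk]
    · intro i _ j _ hij
      rw [Function.onFun, Finset.disjoint_left]
      intro z hz hz'
      exact hij ((mem_cls.1 hz).2.symm.trans (mem_cls.1 hz').2)
  exact_mod_cast h1

theorem cls_dvd {A : Finset ℤ} {q i z w : ℤ} (hz : z ∈ cls A q i) (hw : w ∈ cls A q i) :
    q ∣ z - w :=
  Int.dvd_of_emod_eq_zero (Int.emod_eq_emod_iff_emod_sub_eq_zero.1
    ((mem_cls.1 hz).2.trans (mem_cls.1 hw).2.symm))

theorem emod_dvd {q y z : ℤ} (h : y % q = z % q) : q ∣ y - z :=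
  Int.dvd_of_emod_eq_zero (Int.emod_eq_emod_iff_emod_sub_eq_zero.1 h)

theorem dvd_emod {q y z : ℤ} (h : q ∣ y - z) : y % q = z % q :=
  Int.emod_eq_emod_iff_emod_sub_eq_zero.2 (Int.emod_eq_zero_of_dvd h)

theorem half_facts (A : Finset ℤ) (p q : ℕ) (hp : p.Prime) (hq : q.Prime) (hne : p ≠ q)
    (k : ℤ) (hk : k = p * q) (i : ℤ) (hi : i ∈ A.image (fun z => z % k))
    (h : ℤ) (hh : h ∈ A.image (fun z => z % k)) :
    (Per (Xs A k i) k q ∧ ¬ Ful (Xs A k i) k → Ful (Xs A k i) p ∧ ¬ Ful (Xs A k i) q) ∧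
    (Per (Xs A k i) k q ∧ ¬ Ful (Xs A k i) k → h % q ≠ i % q →
      ((Xs A k i + cls A k i).card : ℤ) + p * (Xs A k h).card ≤ (Xs A k i + A).card) ∧
    (¬ Ful (Xs A k i) q → h % q ≠ i % q →
      ((Xs A k i + cls A k i).card : ℤ) + (cls A q (h % q)).card ≤ (Xs A k i + A).card) ∧
    (Ful (Xs A k i) q →
      ((Xs A k i).card : ℤ) + q * ((cls A q (h % q)).card - 1) ≤ (Xs A k i + A).card) := by
  have hp0 : (0 : ℤ) < p := by exact_mod_cast hp.pos
  have hq0 : (0 : ℤ) < q := by exact_mod_cast hq.pos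
  have hk0 : 0 < k := hk ▸ mul_pos hp0 hq0
  have hqk : (q : ℤ) ∣ k := Dvd.intro_left _ hk.symm
  have hpk : (p : ℤ) ∣ k := Dvd.intro _ hk.symm
  obtain ⟨ai, hai, hi'⟩ := Finset.mem_image.1 hi
  obtain ⟨ah, hah, hh'⟩ := Finset.mem_image.1 hh
  have hXne : (Xs A k i).Nonempty := ⟨ai / k, Finset.mem_image.2 ⟨ai, mem_cls.2 ⟨hai, hi'⟩, rfl⟩⟩
  have hik : i % k = i := by rw [← hi', Int.emod_emod_of_dvd _ dvd_rfl]
  have hhk : h % k = h := by rw [← hh', Int.emod_emod_of_dvd _ dvd_rfl]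
  set X := Xs A k i with hX
  have hcls : ∀ z ∈ cls A k i, k ∣ z - i := fun z hz =>
    emod_dvd (by rw [(mem_cls.1 hz).2, hik])
  have hclsh : ∀ z ∈ cls A k h, k ∣ z - h := fun z hz =>
    emod_dvd (by rw [(mem_cls.1 hz).2, hhk])
  have hclsq : ∀ z ∈ cls A q (h % q), (q : ℤ) ∣ z - h := fun z hz =>
    emod_dvd (by rw [(mem_cls.1 hz).2])
  have hsub : ∀ r j, cls A r j ⊆ A := fun r j => Finset.filter_subset _ _
  have hnp : ¬ Ful X q → h % q ≠ i % q → ¬ Per X q (h - i) := fun hF hne hP =>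
    hF (Per.prime hq hXne hP (fun hd => hne (dvd_emod hd)))
  have hF1 : Per X k q → ¬ Ful X k → ¬ Ful X q := by
    intro hP hF hFq
    apply hF
    intro z
    obtain ⟨x, hx, t, ht⟩ := hFq z
    obtain ⟨y, hy, hd⟩ := hP.mul hk0 (-t) x hx
    exact ⟨y, hy, dvd_cast hd (by linarith)⟩
  refine ⟨?_, ?_, ?_, ?_⟩
  · rintro ⟨hP, hF⟩
    refine ⟨?_, hF1 hP hF⟩
    apply Per.prime hp hXne (d := q)
    · intro x hx
      obtain ⟨y, hy, hd⟩ := hP x hx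
      exact ⟨y, hy, hpk.trans hd⟩
    · intro hd
      have : p ∣ q := by exact_mod_cast hd
      exact hne ((Nat.prime_dvd_prime_iff_eq hp hq).1 this)
  · rintro ⟨hP, hF⟩ hne'
    rw [card_Xs]
    exact gain_many hk hp0 hq0 (hsub _ _) (hsub _ _) (fun z hz => hqk.trans (hcls z hz)) hclsh
      (hnp (hF1 hP hF) hne') hP
  · intro hF hne'
    exact gain_one (hsub _ _) (hsub _ _) (fun z hz => hqk.trans (hcls z hz)) hclsq (hnp hF hne')
  · intro hF
    have h1 := class_bound X (cls A q (h % q)) q ⟨ah, mem_cls.2 ⟨hah, by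
      rw [← hh', Int.emod_emod_of_dvd _ hqk]⟩⟩ (fun y hy z hz => cls_dvd hy hz)
    rw [hF.card hq0] at h1
    refine h1.trans ?_
    exact_mod_cast Finset.card_le_card (Finset.add_subset_add_left (hsub _ _))

theorem mkGeo (A : Finset ℤ) (p q : ℕ) (hp : p.Prime) (hq : q.Prime) (hne : p ≠ q)
    (k : ℤ) (hk : k = p * q)
    (nq : ∀ i ∈ A, ∃ h ∈ A, h % q ≠ i % q) (np : ∀ i ∈ A, ∃ h ∈ A, h % p ≠ i % p) :
    Geo p q k (A.image (fun z => z % k)) (fun i => (Xs A k i).card)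
      (fun i => (Xs A k i + A).card) (fun i => (Xs A k i + cls A k i).card)
      (fun i => ((Xs A k i).image (fun z => z % k)).card)
      (fun i => i % q) (fun i => i % p) (fun h => (cls A q (h % q)).card)
      (fun h => (cls A p (h % p)).card)
      (fun i => Per (Xs A k i) k q ∧ ¬ Ful (Xs A k i) k)
      (fun i => Per (Xs A k i) k p ∧ ¬ Ful (Xs A k i) k)
      (fun i => Ful (Xs A k i) q) (fun i => Ful (Xs A k i) p) := by
  have hp0 : (0 : ℤ) < p := by exact_mod_cast hp.pos
  have hq0 : (0 : ℤ) < q := by exact_mod_cast hq.pos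
  have hk0 : 0 < k := hk ▸ mul_pos hp0 hq0
  have hqk : (q : ℤ) ∣ k := Dvd.intro_left _ hk.symm
  have hpk : (p : ℤ) ∣ k := Dvd.intro _ hk.symm
  have hk' : k = q * p := by rw [hk]; ring
  have H1 := fun i hi h hh => half_facts A p q hp hq hne k hk i hi h hh
  have H2 := fun i hi h hh => half_facts A q p hq hp hne.symm k hk' i hi h hh
  have hsub : ∀ r j, cls A r j ⊆ A := fun r j => Finset.filter_subset _ _
  have hIk : ∀ i ∈ A.image (fun z => z % k), i % k = i := by
    intro i hi
    obtain ⟨ai, hai, rfl⟩ := Finset.mem_image.1 hi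
    simp only [Int.emod_emod_of_dvd _ (dvd_refl k)]
  have hcn : ∀ i ∈ A.image (fun z => z % k), (cls A k i).Nonempty := by
    intro i hi
    obtain ⟨ai, hai, rfl⟩ := Finset.mem_image.1 hi
    exact ⟨ai, mem_cls.2 ⟨hai, rfl⟩⟩
  have hcls : ∀ i ∈ A.image (fun z => z % k), ∀ z ∈ cls A k i, k ∣ z - i := fun i hi z hz =>
    emod_dvd (by rw [(mem_cls.1 hz).2, hIk i hi])
  refine
  { hp := by exact_mod_cast hp.two_le
    hq := by exact_mod_cast hq.two_le
    hk := hk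
    pos := ?_, gf := ?_, hF := ?_, hT := ?_
    ha := fun i hi hT h hh => (H1 i hi h hh).2.1 hT
    hb := fun i hi hT h hh => (H2 i hi h hh).2.1 hT
    aF := fun i hi hT => (H1 i hi i hi).1 hT
    bF := fun i hi hT => (H2 i hi i hi).1 hT
    nFa := fun i hi hT h hh => (H1 i hi h hh).2.2.1 hT
    nFb := fun i hi hT h hh => (H2 i hi h hh).2.2.1 hT
    yFa := fun i hi hT h hh => (H1 i hi h hh).2.2.2 hT
    yFb := fun i hi hT h hh => (H2 i hi h hh).2.2.2 hT
    sa := fun S _ h _ hS => sum_cls_le A S k q h hqk hS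
    sb := fun S _ h _ hS => sum_cls_le A S k p h hpk hS
    inj := ?_, ea := ?_, eb := ?_ }
  · intro i hi
    simp only [card_Xs]
    exact_mod_cast (hcn i hi).card_pos
  · intro i hi
    exact_mod_cast Finset.card_le_card (Finset.add_subset_add_left (hsub _ _))
  · intro i hi h hh
    have h1 := class_bound (Xs A k i) (cls A k h) k (hcn h hh) (fun y hy z hz => cls_dvd hy hz)
    simp only [card_Xs A k h]
    refine h1.trans ?_
    exact_mod_cast Finset.card_le_card (Finset.add_subset_add_left (hsub _ _))
  · intro i hi
    by_cases hF : Ful (Xs A k i) k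
    · left; exact hF.card hk0
    by_cases ha : Per (Xs A k i) k q
    · exact Or.inr (Or.inr (Or.inl ⟨ha, hF⟩))
    by_cases hb : Per (Xs A k i) k p
    · exact Or.inr (Or.inr (Or.inr ⟨hb, hF⟩))
    right; left
    intro h hh hhi
    simp only [card_Xs A k h]
    apply gain_one (hsub _ _) (hsub _ _) (hcls i hi) (hcls h hh)
    intro hP
    have hd : ¬ k ∣ h - i := by
      intro hd
      have := dvd_emod hd
      rw [hIk i hi, hIk h hh] at this
      exact hhi this
    rw [hk] at hP hd ha hb
    rcases Per.two hp hq hP hd with h' | h'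
    · exact hb h'
    · exact ha h'
  · intro i hi h hh h1 h2
    have hco : IsCoprime (p : ℤ) (q : ℤ) := by
      rw [Nat.isCoprime_iff_coprime]
      exact (Nat.coprime_primes hp hq).2 hne
    have := hco.mul_dvd (emod_dvd h2) (emod_dvd h1)
    rw [← hk] at this
    have := dvd_emod this
    rwa [hIk i hi, hIk h hh] at this
  · intro i hi
    obtain ⟨ai, hai, rfl⟩ := Finset.mem_image.1 hi
    obtain ⟨h, hh, hn⟩ := nq ai hai
    refine ⟨h % k, Finset.mem_image.2 ⟨h, hh, rfl⟩, ?_⟩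
    simp only [Int.emod_emod_of_dvd _ hqk]
    exact hn
  · intro i hi
    obtain ⟨ai, hai, rfl⟩ := Finset.mem_image.1 hi
    obtain ⟨h, hh, hn⟩ := np ai hai
    refine ⟨h % k, Finset.mem_image.2 ⟨h, hh, rfl⟩, ?_⟩
    simp only [Int.emod_emod_of_dvd _ hpk]
    exact hn

/-- Normalisation of a set. -/
theorem normalise (A : Finset ℤ) (hA : 2 ≤ A.card) (k : ℤ) :
    ∃ B : Finset ℤ, B.card = A.card ∧
      (B + B.image (fun b => k * b)).card = (A + A.image (fun b => k * b)).card ∧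
      ∀ p : ℕ, p.Prime → ∀ i ∈ B, ∃ h ∈ B, h % p ≠ i % p := by
  obtain ⟨r, hr, r', hr', hrr⟩ := Finset.one_lt_card.1 (by omega : 1 < A.card)
  set d := A.gcd (fun z => z - r) with hd
  have hdd : ∀ z ∈ A, d ∣ z - r := fun z hz => Finset.gcd_dvd hz
  have hd0 : d ≠ 0 := by
    intro h0
    have := hdd r' hr'
    rw [h0, zero_dvd_iff] at this
    exact hrr (by linarith)
  set B := A.image (fun z => (z - r) / d) with hB
  have hAB : A = B.image (fun z => d * z + r) := by
    rw [hB, Finset.image_image]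
    ext z
    simp only [Finset.mem_image, Function.comp]
    constructor
    · intro hz
      exact ⟨z, hz, by rw [Int.mul_ediv_cancel' (hdd z hz)]; ring⟩
    · rintro ⟨y, hy, rfl⟩
      rw [Int.mul_ediv_cancel' (hdd y hy)]
      simpa using hy
  have hinj : ∀ t : ℤ, Function.Injective (fun z : ℤ => d * z + t) := by
    intro t y z h
    simpa [hd0] using h
  refine ⟨B, ?_, ?_, ?_⟩
  · rw [hAB, Finset.card_image_of_injective _ (hinj r)]
  · have : A + A.image (fun b => k * b) =
        (B + B.image (fun b => k * b)).image (fun z => d * z + (r + k * r)) := by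
      rw [hAB]
      ext z
      simp only [Finset.mem_add, Finset.mem_image]
      constructor
      · rintro ⟨_, ⟨y, hy, rfl⟩, _, ⟨_, ⟨w, hw, rfl⟩, rfl⟩, rfl⟩
        exact ⟨y + k * w, ⟨y, hy, k * w, ⟨w, hw, rfl⟩, rfl⟩, by ring⟩
      · rintro ⟨_, ⟨y, hy, _, ⟨w, hw, rfl⟩, rfl⟩, rfl⟩
        exact ⟨_, ⟨y, hy, rfl⟩, _, ⟨_, ⟨w, hw, rfl⟩, rfl⟩, by ring⟩
    rw [this, Finset.card_image_of_injective _ (hinj _)]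
  · intro p hp i hi
    by_contra! hc
    have h0 : (0 : ℤ) ∈ B := Finset.mem_image.2 ⟨r, hr, by simp⟩
    have h1 : ∀ h ∈ B, (p : ℤ) ∣ h := by
      intro h hh
      exact dvd_cast (emod_dvd ((hc h hh).trans (hc 0 h0).symm)) (by ring)
    have h2 : d * p ∣ d := by
      conv_rhs => rw [hd]
      apply Finset.dvd_gcd
      intro z hz
      have := h1 _ (Finset.mem_image.2 ⟨z, hz, rfl⟩)
      have h3 := mul_dvd_mul_left d this
      rwa [Int.mul_ediv_cancel' (hdd z hz)] at h3
    have h3 : (p : ℤ) ∣ 1 := by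
      have : d * p ∣ d * 1 := by simpa using h2
      exact Int.dvd_of_mul_dvd_mul_left hd0 this
    have : p ∣ 1 := by exact_mod_cast h3
    exact hp.one_lt.ne' (Nat.dvd_one.1 this)

theorem card_le_add (A : Finset ℤ) (k : ℤ) : A.card ≤ (A + A.image (fun b => k * b)).card := by
  rcases A.eq_empty_or_nonempty with rfl | hA
  · simp
  · exact Finset.card_le_card_add_right (hA.image _)

theorem card_image_scale (A : Finset ℤ) (k : ℤ) (hk : 0 < k) :
    (A.image (fun b => k * b)).card = A.card := by
  apply Finset.card_image_of_injective
  intro y z h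
  exact mul_left_cancel₀ hk.ne' h

/-- The bound through the number of residue classes. -/
theorem direct_bound (A : Finset ℤ) (k : ℤ) (hk : 0 < k) (hA : A.Nonempty) :
    (A.card : ℤ) + ((A.image (fun z => z % k)).card : ℤ) * ((A.card : ℤ) - 1) ≤
      (A + A.image (fun b => k * b)).card := by
  have h := class_bound A (A.image (fun b => k * b)) k (hA.image _) (by
    intro y hy z hz
    obtain ⟨a, _, rfl⟩ := Finset.mem_image.1 hy
    obtain ⟨b, _, rfl⟩ := Finset.mem_image.1 hz
    exact ⟨a - b, by ring⟩)
  rw [card_image_scale A k hk] at h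
  exact h

theorem sum_excess (A : Finset ℤ) (k L m : ℤ) (hk : 0 < k) :
    ∑ i ∈ A.image (fun z => z % k),
      (((Xs A k i + A).card : ℤ) + L - m * ((Xs A k i).card : ℤ)) =
    (A + A.image (fun b => k * b)).card + (A.image (fun z => z % k)).card * L - m * A.card := by
  rw [Finset.sum_sub_distrib, Finset.sum_add_distrib, ← Finset.mul_sum, sum_cls, card_sum A k hk]
  simp

theorem weak_bound (p q : ℕ) (hp : p.Prime) (hq : q.Prime) (hne : p ≠ q)
    (k : ℤ) (hk : k = p * q) (s : ℕ) : (s : ℤ) ≤ k → ∀ A : Finset ℤ,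
    ((s : ℤ) + 1) * A.card - (s.factorial : ℤ) ≤ (A + A.image (fun b => k * b)).card := by
  have hk0 : 0 < k := by
    rw [hk]; exact mul_pos (by exact_mod_cast hp.pos) (by exact_mod_cast hq.pos)
  induction s with
  | zero =>
    intro _ A
    have : (A.card : ℤ) ≤ (A + A.image (fun b => k * b)).card := by
      exact_mod_cast card_le_add A k
    simp only [Nat.factorial_zero]
    push_cast
    linarith
  | succ s ih =>
    intro hsk A
    have ih := ih (by push_cast at hsk; linarith)
    have hfac : ((s + 1 : ℕ) : ℤ) ≤ ((s + 1).factorial : ℤ) := by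
      exact_mod_cast Nat.self_le_factorial _
    by_cases hA : A.card ≤ 1
    · have h1 : (A.card : ℤ) ≤ (A + A.image (fun b => k * b)).card := by
        exact_mod_cast card_le_add A k
      have h2 : (A.card : ℤ) ≤ 1 := by exact_mod_cast hA
      have h3 : (0 : ℤ) ≤ ((s + 1 : ℕ) : ℤ) := by positivity
      nlinarith
    obtain ⟨B, hB1, hB2, hB3⟩ := normalise A (by omega) k
    rw [← hB1, ← hB2]
    have hBn : B.Nonempty := by rw [← Finset.card_pos]; omega
    have hB1' : (1 : ℤ) ≤ B.card := by exact_mod_cast hBn.card_pos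
    by_cases hj : s + 1 ≤ (B.image (fun z => z % k)).card
    · have h1 := direct_bound B k hk0 hBn
      have hj' : ((s + 1 : ℕ) : ℤ) ≤ (B.image (fun z => z % k)).card := by exact_mod_cast hj
      nlinarith
    · have G := mkGeo B p q hp hq hne k hk (hB3 q hq) (hB3 p hp)
      have h1 := G.weak ((s + 1 : ℕ) : ℤ) (max (s.factorial : ℤ) ((s + 1 : ℕ) : ℤ))
        (by push_cast; linarith [Nat.cast_nonneg (α := ℤ) s]) hsk (le_max_right _ _) (by
          intro i _
          have h := ih (cls B k i)
          rw [card_scale B (cls B k i) k i hk0, card_Xs]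
          have := le_max_left (s.factorial : ℤ) ((s + 1 : ℕ) : ℤ)
          push_cast at h this ⊢
          linarith)
      rw [sum_excess B k _ _ hk0] at h1
      have hj' : ((B.image (fun z => z % k)).card : ℤ) ≤ s := by
        have : (B.image (fun z => z % k)).card ≤ s := by omega
        exact_mod_cast this
      have hs0 : (0 : ℤ) ≤ s := by positivity
      have hf0 : (0 : ℤ) ≤ s.factorial := by positivity
      have hss : (s : ℤ) ≤ s.factorial := by exact_mod_cast Nat.self_le_factorial _
      have h2 : (s : ℤ) * max (s.factorial : ℤ) ((s + 1 : ℕ) : ℤ) ≤ ((s + 1).factorial : ℤ) := by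
        rw [Nat.factorial_succ]
        push_cast
        rcases max_cases (s.factorial : ℤ) ((s : ℤ) + 1) with ⟨h, _⟩ | ⟨h, _⟩ <;> rw [h] <;>
          nlinarith
      have h3 : ((B.image (fun z => z % k)).card : ℤ) * max (s.factorial : ℤ) ((s + 1 : ℕ) : ℤ) ≤
          (s : ℤ) * max (s.factorial : ℤ) ((s + 1 : ℕ) : ℤ) :=
        mul_le_mul_of_nonneg_right hj' (hf0.trans (le_max_left _ _))
      linarith

/-- Extra elements coming from the other largest classes. -/
theorem extra (A X T : Finset ℤ) (k : ℤ) (hX : X.Nonempty) (hT : T.Nonempty)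
    (hTn : ∀ h ∈ T, (cls A k h).Nonempty) :
    ∃ h ∈ T, (X + cls A k h).card + (T.card - 1) ≤ (X + A).card := by
  classical
  have hm : ∀ h : ℤ, ∃ m : ℤ, h ∈ T → m ∈ cls A k h ∧ ∀ z ∈ cls A k h, m ≤ z := by
    intro h
    by_cases hh : h ∈ T
    · exact ⟨(cls A k h).min' (hTn h hh), fun _ => ⟨Finset.min'_mem _ _,
        fun z hz => Finset.min'_le _ _ hz⟩⟩
    · exact ⟨0, fun h' => absurd h' hh⟩
  choose m hm using hm
  obtain ⟨h0, hh0, hmax⟩ := T.exists_max_image m hT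
  refine ⟨h0, hh0, ?_⟩
  have hinj : Set.InjOn m T := by
    intro y hy z hz h
    have h1 := (mem_cls.1 (hm y hy).1).2
    have h2 := (mem_cls.1 (hm z hz).1).2
    rw [← h1, ← h2, h]
  have hcard : ((T.erase h0).image (fun h => X.min' hX + m h)).card = T.card - 1 := by
    rw [Finset.card_image_of_injOn, Finset.card_erase_of_mem hh0]
    intro y hy z hz h
    exact hinj (Finset.mem_of_mem_erase hy) (Finset.mem_of_mem_erase hz) (add_left_cancel h)
  rw [← hcard]
  apply gain X A (cls A k h0) _ (Finset.filter_subset _ _)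
  · intro z hz
    obtain ⟨h, hh, rfl⟩ := Finset.mem_image.1 hz
    exact Finset.add_mem_add (Finset.min'_mem _ _)
      (mem_cls.1 (hm h (Finset.mem_of_mem_erase hh)).1).1
  · intro z hz hz'
    obtain ⟨h, hh, rfl⟩ := Finset.mem_image.1 hz
    obtain ⟨y, hy, w, hw, e⟩ := Finset.mem_add.1 hz'
    have hhT := Finset.mem_of_mem_erase hh
    have h1 := hmax h hhT
    have h2 := (hm h0 hh0).2 w hw
    have h3 := Finset.min'_le X y hy
    have h4 : m h = m h0 := by linarith
    exact (Finset.mem_erase.1 hh).1 (hinj hhT hh0 h4)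

/-- The fully distributed case. -/
theorem full_case (A : Finset ℤ) (k : ℤ) (hk : 0 < k) (hA : A.Nonempty)
    (hj : ((A.image (fun z => z % k)).card : ℤ) ≤ k)
    (hc : ∀ i ∈ A.image (fun z => z % k), (((Xs A k i).image (fun z => z % k)).card : ℤ) = k) :
    (k + 1) * A.card - ((A.image (fun z => z % k)).card : ℤ) *
      (k + 1 - (A.image (fun z => z % k)).card) ≤ (A + A.image (fun b => k * b)).card := by
  classical
  set I := A.image (fun z => z % k) with hI
  have hIn : I.Nonempty := hA.image _
  have hcn : ∀ i ∈ I, (cls A k i).Nonempty := by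
    intro i hi
    obtain ⟨a, ha, h⟩ := Finset.mem_image.1 hi
    exact ⟨a, mem_cls.2 ⟨ha, h⟩⟩
  obtain ⟨o, ho, hmax⟩ := I.exists_max_image (fun i => (Xs A k i).card) hIn
  set n := (Xs A k o).card with hn
  set T := I.filter (fun i => (Xs A k i).card = n) with hT
  have hTn : T.Nonempty := ⟨o, Finset.mem_filter.2 ⟨ho, rfl⟩⟩
  have hT1 : (1 : ℤ) ≤ T.card := by exact_mod_cast hTn.card_pos
  have hf : ∀ i ∈ I, ((Xs A k i).card : ℤ) + k * ((n : ℤ) - 1) + (T.card - 1) ≤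
      (Xs A k i + A).card := by
    intro i hi
    obtain ⟨h, hh, hx⟩ := extra A (Xs A k i) T k ((hcn i hi).image _) hTn
      (fun h hh => hcn h (Finset.mem_filter.1 hh).1)
    have hb := class_bound (Xs A k i) (cls A k h) k (hcn h (Finset.mem_filter.1 hh).1)
      (fun y hy z hz => cls_dvd hy hz)
    rw [hc i hi, ← card_Xs A k h, (Finset.mem_filter.1 hh).2] at hb
    have hx' : ((Xs A k i + cls A k h).card : ℤ) + (T.card - 1) ≤ (Xs A k i + A).card := by
      have := hTn.card_pos
      zify [this] at hx
      exact hx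
    linarith
  have hsum : (k : ℤ) * (I.card - T.card) ≤ ∑ i ∈ I, k * ((n : ℤ) - (Xs A k i).card) := by
    rw [← Finset.mul_sum]
    apply mul_le_mul_of_nonneg_left _ hk.le
    have h1 : ∑ i ∈ I, (1 - if (Xs A k i).card = n then (1 : ℤ) else 0) ≤
        ∑ i ∈ I, ((n : ℤ) - (Xs A k i).card) := by
      apply Finset.sum_le_sum
      intro i hi
      have h := hmax i hi
      split_ifs with h'
      · rw [h']; simp
      · have : (Xs A k i).card < n := lt_of_le_of_ne h h'
        have : ((Xs A k i).card : ℤ) < n := by exact_mod_cast this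
        linarith
    refine le_trans (le_of_eq ?_) h1
    rw [Finset.sum_sub_distrib, Finset.sum_boole, ← hT]
    simp
  have hS := Finset.sum_le_sum hf
  have hC : ((A + A.image (fun b => k * b)).card : ℤ) = ∑ i ∈ I, ((Xs A k i + A).card : ℤ) := by
    rw [card_sum A k hk]; push_cast; rfl
  have hsc := sum_cls A k
  rw [← hI] at hsc
  have e1 : ∑ i ∈ I, (((Xs A k i).card : ℤ) + k * ((n : ℤ) - 1) + (T.card - 1)) =
      (A.card : ℤ) + I.card * (k * (n - 1) + (T.card - 1)) := by
    simp only [Finset.sum_add_distrib, hsc, Finset.sum_const, nsmul_eq_mul]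
    ring
  have e2 : ∑ i ∈ I, k * ((n : ℤ) - (Xs A k i).card) = k * (I.card * n - A.card) := by
    rw [← Finset.mul_sum, Finset.sum_sub_distrib, hsc]
    simp
  rw [e1] at hS
  rw [e2] at hsum
  have hTI : (T.card : ℤ) ≤ I.card := by exact_mod_cast Finset.card_filter_le _ _
  rw [hC]
  nlinarith [mul_nonneg (sub_nonneg.2 hTI) (sub_nonneg.2 hj)]

theorem sharp_bound (p q : ℕ) (hp : p.Prime) (hq : q.Prime) (hne : p ≠ q)
    (k : ℕ) (hk : k = p * q) (A : Finset ℤ) (hA : (k - 1) ^ 2 * Nat.factorial k ≤ A.card) :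
    ∃ j : ℤ, ((k : ℤ) + 1) * A.card - j * (k + 1 - j) ≤
      ((A + A.image (fun b => (k : ℤ) * b)).card : ℤ) := by
  have hk4 : 4 ≤ k := by
    rw [hk]; exact Nat.mul_le_mul hp.two_le hq.two_le
  have hk0 : (0 : ℤ) < k := by exact_mod_cast (by omega : 0 < k)
  have hkk : (k : ℤ) = p * q := by rw [hk]; push_cast; rfl
  have hfk : k ≤ k.factorial := Nat.self_le_factorial k
  have hA2 : 2 ≤ A.card := by
    refine le_trans ?_ hA
    have : 1 ≤ (k - 1) ^ 2 := Nat.one_le_pow _ _ (by omega)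
    nlinarith
  obtain ⟨B, hB1, hB2, hB3⟩ := normalise A hA2 k
  rw [← hB1] at hA
  rw [← hB1, ← hB2]
  have hBn : B.Nonempty := by rw [← Finset.card_pos]; omega
  have hjk := card_res_le B hk0
  by_cases hj : ((B.image (fun z => z % (k : ℤ))).card : ℤ) = k
  · refine ⟨k, ?_⟩
    have h1 := direct_bound B k hk0 hBn
    rw [hj] at h1
    linarith
  by_cases hc : ∀ i ∈ B.image (fun z => z % (k : ℤ)),
      (((Xs B k i).image (fun z => z % (k : ℤ))).card : ℤ) = k
  · exact ⟨_, full_case B k hk0 hBn hjk hc⟩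
  push Not at hc
  obtain ⟨e, he, hce⟩ := hc
  have G := mkGeo B p q hp hq hne k hkk (hB3 q hq) (hB3 p hp)
  obtain ⟨o, ho, hmax⟩ := (B.image (fun z => z % (k : ℤ))).exists_max_image
    (fun i => ((Xs B k i).card : ℤ)) (hBn.image _)
  have h1 := G.sharp (k.factorial : ℤ) (by exact_mod_cast hfk) (by
    intro i _
    have h := weak_bound p q hp hq hne k hkk k le_rfl (cls B k i)
    rw [card_scale B (cls B k i) k i hk0, card_Xs]
    exact h) o ho hmax e he hce
  rw [sum_excess B k _ _ hk0] at h1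
  refine ⟨0, ?_⟩
  set j : ℤ := ((B.image (fun z => z % (k : ℤ))).card : ℤ) with hjd
  set n : ℤ := ((Xs B k o).card : ℤ) with hn
  have hj1 : j ≤ k - 1 := by
    have := lt_of_le_of_ne hjk hj
    linarith [Int.add_one_le_iff.2 this]
  have hsum : (B.card : ℤ) ≤ j * n := by
    rw [← sum_cls B k]
    have := Finset.sum_le_card_nsmul _ _ n hmax
    rw [nsmul_eq_mul] at this
    exact this
  have hA' : ((k : ℤ) - 1) ^ 2 * (k.factorial : ℤ) ≤ B.card := by
    have : ((((k - 1) ^ 2 * k.factorial : ℕ)) : ℤ) ≤ B.card := by exact_mod_cast hA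
    rw [Nat.cast_mul, Nat.cast_pow, Nat.cast_sub (by omega)] at this
    exact_mod_cast this
  have hn0 : 0 ≤ n := by positivity
  have hF0 : (0 : ℤ) ≤ k.factorial := by positivity
  have hk4' : (4 : ℤ) ≤ k := by exact_mod_cast hk4
  have h2 : ((k : ℤ) - 1) * ((k - 1) * (k.factorial : ℤ)) ≤ (k - 1) * n := by
    nlinarith [mul_le_mul_of_nonneg_right hj1 hn0]
  have h3 : ((k : ℤ) - 1) * (k.factorial : ℤ) ≤ n := le_of_mul_le_mul_left h2 (by linarith)
  have h4 := mul_le_mul_of_nonneg_right hj1 hF0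
  linarith

/-- Let `p₁`, `p₂` be distinct primes and `k = p₁p₂`. Let `A` be a finite set of integers
with `|A| ≥ (k−1)²·k!`. Then `|A + k·A| ≥ (k+1)|A| − ⌈k(k+2)/4⌉`. -/
theorem stmt_1 (p₁ p₂ : ℕ) (hp₁ : p₁.Prime) (hp₂ : p₂.Prime) (hne : p₁ ≠ p₂)
    (k : ℕ) (hk : k = p₁ * p₂)
    (A : Finset ℤ) (hA : (k - 1) ^ 2 * Nat.factorial k ≤ A.card) :
    ((k : ℤ) + 1) * A.card - ⌈((k : ℚ) * ((k : ℚ) + 2)) / 4⌉ ≤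
      ((A + A.image (fun b => (k : ℤ) * b)).card : ℤ) := by
  obtain ⟨j, hj⟩ := sharp_bound p₁ p₂ hp₁ hp₂ hne k hk A hA
  have h : j * ((k : ℤ) + 1 - j) - 1 < ⌈((k : ℚ) * ((k : ℚ) + 2)) / 4⌉ := by
    rw [Int.lt_ceil]
    push_cast
    have h1 := sq_nonneg ((k : ℚ) + 1 - 2 * j)
    rw [lt_div_iff₀ (by norm_num)]
    nlinarith
  linarith [Int.sub_one_lt_iff.1 h]
end
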